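/- arXiv:2012.07129 — 5 statements merged into one kernel-verified Lean document; each statement's English description precedes it below -/
import Mathlib

section
/- Let f : (0,∞) → ℝ be continuously differentiable and non-decreasing, with the scale-invariance property: for every finite set R ⊂ ℝ and every s > 0, a matching M is an f(·)-minimal 1-colour matching of R if and only if sM is an f(·)-minimal 1-colour matching of sR. Suppose f'(1) > 0, and let δ > 0 satisfy 2f(1+δ) < f(2) + f(1) and f'(x) > 0 for all x ∈ [1, 1+δ]. Then for all x, z ∈ [1, 1+δ] and all s > 0, f'(sx)/f'(x) = f'(sz)/f'(z). -/
open Set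

/-- The cost function `f_γ`. -/
noncomputable def fgam (γ x : ℝ) : ℝ :=
  if 0 < γ then x ^ γ else if γ = 0 then Real.log x else -(x ^ γ)

variable {α : Type*} [MetricSpace α]

/-- The length of an unordered pair of points. -/
noncomputable def edgeLen : Sym2 α → ℝ :=
  Sym2.lift ⟨fun x y => dist x y, fun x y => dist_comm x y⟩

/-- `M` is a 1-colour (partial) matching of `R`. -/
def IsMatch1 (R : Set α) (M : Set (Sym2 α)) : Prop :=
  (∀ e ∈ M, ¬ e.IsDiag ∧ ∀ x ∈ e, x ∈ R) ∧
  (∀ e ∈ M, ∀ e' ∈ M, ∀ x : α, x ∈ e → x ∈ e' → e = e')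

/-- `x` is matched in the 1-colour matching `M`. -/
def matched1 (M : Set (Sym2 α)) (x : α) : Prop := ∃ e ∈ M, x ∈ e

/-- Number of unmatched points of `R` in `M`. -/
noncomputable def unm1 (R : Set α) (M : Set (Sym2 α)) : ℕ :=
  {x ∈ R | ¬ matched1 M x}.ncard

/-- The total cost of a 1-colour matching. -/
noncomputable def cost1 (f : ℝ → ℝ) (M : Set (Sym2 α)) : ℝ :=
  ∑ᶠ e ∈ M, f (edgeLen e)

/-- Lexicographic comparison of (number of unmatched points, cost). -/
def lexLe (u : ℕ) (c : ℝ) (u' : ℕ) (c' : ℝ) : Prop :=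
  u < u' ∨ (u = u' ∧ c ≤ c')

/-- `M` is an `f`-minimal 1-colour matching of the finite set `R`. -/
def FinMin1 (f : ℝ → ℝ) (R : Set α) (M : Set (Sym2 α)) : Prop :=
  IsMatch1 R M ∧
  ∀ m : Set (Sym2 α), IsMatch1 R m →
    lexLe (unm1 R M) (cost1 f M) (unm1 R m) (cost1 f m)

/-- `M` is a 2-colour (partial) matching of `R` and `B`. -/
def IsMatch2 (R B : Set α) (M : Set (α × α)) : Prop :=
  (∀ e ∈ M, e.1 ∈ R ∧ e.2 ∈ B) ∧
  (∀ x y y' : α, (x, y) ∈ M → (x, y') ∈ M → y = y') ∧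
  (∀ x x' y : α, (x, y) ∈ M → (x', y) ∈ M → x = x')

/-- Number of unmatched points in a 2-colour matching. -/
noncomputable def unm2 (R B : Set α) (M : Set (α × α)) : ℕ :=
  {x ∈ R | ¬ ∃ y, (x, y) ∈ M}.ncard + {y ∈ B | ¬ ∃ x, (x, y) ∈ M}.ncard

/-- The total cost of a 2-colour matching. -/
noncomputable def cost2 (f : ℝ → ℝ) (M : Set (α × α)) : ℝ :=
  ∑ᶠ e ∈ M, f (dist e.1 e.2)

/-- `M` is an `f`-minimal 2-colour matching of the finite sets `R`, `B`. -/
def FinMin2 (f : ℝ → ℝ) (R B : Set α) (M : Set (α × α)) : Prop :=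
  IsMatch2 R B M ∧
  ∀ m : Set (α × α), IsMatch2 R B m →
    lexLe (unm2 R B M) (cost2 f M) (unm2 R B m) (cost2 f m)

/-- `R'` is compatible with the 1-colour matching `M`. -/
def Compat1 (M : Set (Sym2 α)) (R' : Set α) : Prop :=
  ∀ e ∈ M, (∃ x ∈ e, x ∈ R') → ∀ y ∈ e, y ∈ R'

/-- Restriction of a 1-colour matching to a subset of points. -/
def restr1 (M : Set (Sym2 α)) (R' : Set α) : Set (Sym2 α) :=
  {e ∈ M | ∀ x ∈ e, x ∈ R'}

/-- `M` is an `f`-minimal 1-colour matching of a (possibly infinite) set `R`. -/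
def Min1 (f : ℝ → ℝ) (R : Set α) (M : Set (Sym2 α)) : Prop :=
  IsMatch1 R M ∧
  ∀ R' : Set α, R' ⊆ R → R'.Finite → Compat1 M R' → FinMin1 f R' (restr1 M R')

/-- `(R', B')` is compatible with the 2-colour matching `M`. -/
def Compat2 (M : Set (α × α)) (R' B' : Set α) : Prop :=
  ∀ e ∈ M, (e.1 ∈ R' ∨ e.2 ∈ B') → (e.1 ∈ R' ∧ e.2 ∈ B')

/-- Restriction of a 2-colour matching. -/
def restr2 (M : Set (α × α)) (R' B' : Set α) : Set (α × α) :=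
  {e ∈ M | e.1 ∈ R' ∧ e.2 ∈ B'}

/-- `M` is an `f`-minimal 2-colour matching of possibly infinite sets `R`, `B`. -/
def Min2 (f : ℝ → ℝ) (R B : Set α) (M : Set (α × α)) : Prop :=
  IsMatch2 R B M ∧
  ∀ R' B' : Set α, R' ⊆ R → B' ⊆ B → R'.Finite → B'.Finite →
    Compat2 M R' B' → FinMin2 f R' B' (restr2 M R' B')

open Classical in
noncomputable def lens1 (M : Set (Sym2 α)) : Multiset ℝ :=
  if h : M.Finite then h.toFinset.val.map edgeLen else 0

open Classical in
noncomputable def lens2 (M : Set (α × α)) : Multiset ℝ :=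
  if h : M.Finite then h.toFinset.val.map (fun e => dist e.1 e.2) else 0

/-- Increasing rearrangement of a multiset of reals, padded with `⊥ = -∞`. -/
noncomputable def incSeq (s : Multiset ℝ) : ℕ → EReal := fun n =>
  ((s.sort (· ≤ ·)).map (fun x : ℝ => (x : EReal))).getD n ⊥

/-- Decreasing rearrangement of a multiset of reals, padded with `⊥ = -∞`. -/
noncomputable def decSeq (s : Multiset ℝ) : ℕ → EReal := fun n =>
  ((s.sort (· ≤ ·)).reverse.map (fun x : ℝ => (x : EReal))).getD n ⊥

/-- Lexicographic (non-strict) comparison of sequences. -/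
def seqLex (a b : ℕ → EReal) : Prop :=
  a = b ∨ ∃ n : ℕ, (∀ m : ℕ, m < n → a m = b m) ∧ a n < b n

/-- Lexicographic comparison of (number of unmatched points, length sequence). -/
def lexSeqLe (u : ℕ) (a : ℕ → EReal) (u' : ℕ) (b : ℕ → EReal) : Prop :=
  u < u' ∨ (u = u' ∧ seqLex a b)

/-- `M` is a `(-∞)`-minimal 1-colour matching of the finite set `R`. -/
def FinNegMin1 (R : Set α) (M : Set (Sym2 α)) : Prop :=
  IsMatch1 R M ∧ ∀ m : Set (Sym2 α), IsMatch1 R m →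
    lexSeqLe (unm1 R M) (incSeq (lens1 M)) (unm1 R m) (incSeq (lens1 m))

/-- `M` is an `∞`-minimal 1-colour matching of the finite set `R`. -/
def FinPosMin1 (R : Set α) (M : Set (Sym2 α)) : Prop :=
  IsMatch1 R M ∧ ∀ m : Set (Sym2 α), IsMatch1 R m →
    lexSeqLe (unm1 R M) (decSeq (lens1 M)) (unm1 R m) (decSeq (lens1 m))

/-- `M` is a `(-∞)`-minimal 2-colour matching of the finite sets `R`, `B`. -/
def FinNegMin2 (R B : Set α) (M : Set (α × α)) : Prop :=
  IsMatch2 R B M ∧ ∀ m : Set (α × α), IsMatch2 R B m →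
    lexSeqLe (unm2 R B M) (incSeq (lens2 M)) (unm2 R B m) (incSeq (lens2 m))

/-- `M` is an `∞`-minimal 2-colour matching of the finite sets `R`, `B`. -/
def FinPosMin2 (R B : Set α) (M : Set (α × α)) : Prop :=
  IsMatch2 R B M ∧ ∀ m : Set (α × α), IsMatch2 R B m →
    lexSeqLe (unm2 R B M) (decSeq (lens2 M)) (unm2 R B m) (decSeq (lens2 m))

/-- `M` is a `(-∞)`-minimal 1-colour matching of a (possibly infinite) set `R`. -/
def NegMin1 (R : Set α) (M : Set (Sym2 α)) : Prop :=
  IsMatch1 R M ∧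
  ∀ R' : Set α, R' ⊆ R → R'.Finite → Compat1 M R' → FinNegMin1 R' (restr1 M R')

/-- `M` is a `(-∞)`-minimal 2-colour matching of possibly infinite `R`, `B`. -/
def NegMin2 (R B : Set α) (M : Set (α × α)) : Prop :=
  IsMatch2 R B M ∧
  ∀ R' B' : Set α, R' ⊆ R → B' ⊆ B → R'.Finite → B'.Finite →
    Compat2 M R' B' → FinNegMin2 R' B' (restr2 M R' B')

/-- `x` lies strictly between `a` and `b`. -/
def btw (a b x : ℝ) : Prop := min a b < x ∧ x < max a b

/-- The four reals are pairwise distinct. -/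
def distinct4 (a b c d : ℝ) : Prop :=
  a ≠ b ∧ a ≠ c ∧ a ≠ d ∧ b ≠ c ∧ b ≠ d ∧ c ≠ d

/-- The edges `{a,b}` and `{c,d}` are entwined. -/
def EntwinedP (a b c d : ℝ) : Prop :=
  distinct4 a b c d ∧ Xor' (btw a b c) (btw a b d)

/-- The edge `{a,b}` straddles the edge `{c,d}`. -/
def StraddleP (a b c d : ℝ) : Prop := btw a b c ∧ btw a b d

/-- `M` is a `(1+)`-minimal 1-colour matching of a finite set `R ⊂ ℝ`. -/
def OnePlusMin1 (R : Set ℝ) (M : Set (Sym2 ℝ)) : Prop :=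
  FinMin1 (fgam 1) R M ∧
  ∀ a b a' b' : ℝ, s(a, b) ∈ M → s(a', b') ∈ M → ¬ StraddleP a b a' b'

/-- `M` is a `(1-)`-minimal 1-colour matching of a finite set `R ⊂ ℝ`. -/
def OneMinusMin1 (R : Set ℝ) (M : Set (Sym2 ℝ)) : Prop :=
  FinMin1 (fgam 1) R M ∧
  ∀ a b a' b' : ℝ, s(a, b) ∈ M → s(a', b') ∈ M → ¬ EntwinedP a b a' b'

/-- `M` is a `(1+)`-minimal 2-colour matching of finite sets `R, B ⊂ ℝ`. -/
def OnePlusMin2 (R B : Set ℝ) (M : Set (ℝ × ℝ)) : Prop :=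
  FinMin2 (fgam 1) R B M ∧
  ∀ e ∈ M, ∀ e' ∈ M, ¬ StraddleP e.1 e.2 e'.1 e'.2

/-- `M` is a `(1-)`-minimal 2-colour matching of finite sets `R, B ⊂ ℝ`. -/
def OneMinusMin2 (R B : Set ℝ) (M : Set (ℝ × ℝ)) : Prop :=
  FinMin2 (fgam 1) R B M ∧
  ∀ e ∈ M, ∀ e' ∈ M, ¬ EntwinedP e.1 e.2 e'.1 e'.2


/-- The image of a 1-colour matching of reals under scaling by `s`. -/
def scaleM (s : ℝ) (M : Set (Sym2 ℝ)) : Set (Sym2 ℝ) := (Sym2.map fun x => s * x) '' M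

/-- `f` has the scale-invariance property: for every finite `R ⊂ ℝ` and `s > 0`,
`M` is `f`-minimal for `R` iff `sM` is `f`-minimal for `sR`. -/
def ScaleInv (f : ℝ → ℝ) : Prop :=
  ∀ R : Set ℝ, R.Finite → ∀ s : ℝ, 0 < s → ∀ M : Set (Sym2 ℝ),
    (FinMin1 f R M ↔ FinMin1 f ((fun x => s * x) '' R) (scaleM s M))

lemma aux_count (R : Set ℝ) (hR : R.Finite) (m : Set (Sym2 ℝ)) (hm : IsMatch1 R m) :
    m.Finite ∧ 2 * m.ncard + unm1 R m = R.ncard := by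
  classical
  have hfin : m.Finite := by
    have h2 : (R.sym2).Finite := by
      have := (hR.toFinset.sym2).finite_toSet
      refine this.subset ?_
      intro e he
      simp only [Finset.mem_coe, Finset.mem_sym2_iff, Set.Finite.mem_toFinset]
      intro y hy
      exact (Set.mem_sym2_iff_subset.mp he) hy
    refine h2.subset ?_
    intro e he
    rw [Set.mem_sym2_iff_subset]
    intro y hy
    exact (hm.1 e he).2 y hy
  refine ⟨hfin, ?_⟩
  set U : Finset ℝ := hfin.toFinset.biUnion (fun e => e.toFinset) with hU
  have hUcard : U.card = 2 * m.ncard := by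
    rw [hU, Finset.card_biUnion]
    · rw [Finset.sum_congr rfl (g := fun _ => 2)]
      · rw [Finset.sum_const, Set.ncard_eq_toFinset_card m hfin]
        simp [mul_comm]
      · intro e he
        exact Sym2.card_toFinset_of_not_isDiag e (hm.1 e (by simpa using he)).1
    · intro e he e' he' hne
      rw [Function.onFun, Finset.disjoint_left]
      intro y hy hy'
      rw [Sym2.mem_toFinset] at hy hy'
      exact hne (hm.2 e (by simpa using he) e' (by simpa using he') y hy hy')
  have hUset : (U : Set ℝ) = {x ∈ R | matched1 m x} := by
    ext y
    simp only [hU, Finset.coe_biUnion, Set.mem_iUnion, Set.mem_setOf_eq, matched1]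
    constructor
    · rintro ⟨e, he, hy⟩
      have he' : e ∈ m := by simpa using he
      have hy' : y ∈ e := by simpa using hy
      exact ⟨(hm.1 e he').2 y hy', e, he', hy'⟩
    · rintro ⟨_, e, he, hy⟩
      exact ⟨e, by simpa using he, by simpa using hy⟩
  have h3 : {x ∈ R | matched1 m x}.ncard = 2 * m.ncard := by
    rw [← hUset, Set.ncard_coe_finset, hUcard]
  have h4 : R = {x ∈ R | matched1 m x} ∪ {x ∈ R | ¬ matched1 m x} := by
    ext y; simp only [Set.mem_union, Set.mem_setOf_eq]; tauto
  have h5 : R.ncard = {x ∈ R | matched1 m x}.ncard + {x ∈ R | ¬ matched1 m x}.ncard := by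
    conv_lhs => rw [h4]
    apply Set.ncard_union_eq
    · rw [Set.disjoint_left]; rintro y ⟨_, h⟩ ⟨_, h'⟩; exact h' h
    · exact hR.subset (fun y hy => hy.1)
    · exact hR.subset (fun y hy => hy.1)
  rw [h5, h3, unm1]

lemma aux_pair (f : ℝ → ℝ) (R : Set ℝ) (hR : R.Finite) (hc : R.ncard = 5)
    (w x y z : ℝ) (hw : w ∈ R) (hx : x ∈ R) (hy : y ∈ R) (hz : z ∈ R)
    (h1 : w < x) (h2 : x < y) (h3 : y < z) :
    IsMatch1 R {s(w, x), s(y, z)} ∧ unm1 R {s(w, x), s(y, z)} = 1 ∧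
      cost1 f {s(w, x), s(y, z)} = f (x - w) + f (z - y) := by
  have hne : s(w, x) ≠ s(y, z) := by
    intro h
    rw [Sym2.eq_iff] at h
    rcases h with ⟨h, _⟩ | ⟨h, _⟩ <;> linarith
  have hm : IsMatch1 R {s(w, x), s(y, z)} := by
    constructor
    · intro e he
      simp only [Set.mem_insert_iff, Set.mem_singleton_iff] at he
      rcases he with rfl | rfl
      · refine ⟨by simp [Sym2.mk_isDiag_iff, h1.ne], ?_⟩
        intro t ht
        rcases Sym2.mem_iff.mp ht with rfl | rfl <;> assumption
      · refine ⟨by simp [Sym2.mk_isDiag_iff, h3.ne], ?_⟩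
        intro t ht
        rcases Sym2.mem_iff.mp ht with rfl | rfl <;> assumption
    · intro e he e' he' t ht ht'
      simp only [Set.mem_insert_iff, Set.mem_singleton_iff] at he he'
      rcases he with rfl | rfl <;> rcases he' with rfl | rfl
      · rfl
      · exfalso
        rw [Sym2.mem_iff] at ht ht'
        rcases ht with h | h <;> rcases ht' with h' | h' <;> linarith
      · exfalso
        rw [Sym2.mem_iff] at ht ht'
        rcases ht with h | h <;> rcases ht' with h' | h' <;> linarith
      · rfl
  refine ⟨hm, ?_, ?_⟩
  · have := (aux_count R hR _ hm).2
    rw [Set.ncard_pair hne, hc] at this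
    omega
  · rw [cost1, finsum_mem_pair hne]
    simp only [edgeLen, Sym2.lift_mk, Real.dist_eq]
    rw [abs_sub_comm w x, abs_sub_comm y z, abs_of_pos (by linarith), abs_of_pos (by linarith)]

lemma aux_card (p0 p1 p2 p3 p4 : ℝ) (h0 : p0 < p1) (h1 : p1 < p2) (h2 : p2 < p3) (h3 : p3 < p4) :
    ({p0, p1, p2, p3, p4} : Set ℝ).ncard = 5 := by
  rw [Set.ncard_insert_of_notMem, Set.ncard_insert_of_notMem, Set.ncard_insert_of_notMem,
    Set.ncard_pair]
  all_goals
    try simp only [Set.mem_insert_iff, Set.mem_singleton_iff]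
    grind

lemma aux_edge (f : ℝ → ℝ) (hmono : MonotoneOn f (Set.Ioi 0)) (a b c d : ℝ)
    (ha : 1 ≤ a) (hb : 1 ≤ b) (hc : 1 ≤ c) (hd : 1 ≤ d) (e : Sym2 ℝ) (he : ¬ e.IsDiag)
    (hR : ∀ x ∈ e, x ∈ ({0, a, a+b, a+b+c, a+b+c+d} : Set ℝ)) :
    f 1 ≤ f (edgeLen e) ∧ (f 2 ≤ f (edgeLen e) ∨ e = s(0, a) ∨ e = s(a, a+b) ∨
      e = s(a+b, a+b+c) ∨ e = s(a+b+c, a+b+c+d)) := by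
  induction e using Sym2.ind with
  | _ x y =>
  wlog hxy : x ≤ y generalizing x y
  · have := this y x (by rwa [Sym2.eq_swap]) (by rwa [Sym2.eq_swap]) (by linarith)
    rwa [Sym2.eq_swap]
  have hne : x ≠ y := by simpa [Sym2.mk_isDiag_iff] using he
  have hlt := lt_of_le_of_ne hxy hne
  have hlen : edgeLen s(x, y) = y - x := by
    simp only [edgeLen, Sym2.lift_mk, Real.dist_eq]
    rw [abs_sub_comm, abs_of_pos (by linarith)]
  rw [hlen]
  have key : 1 ≤ y - x ∧ (2 ≤ y - x ∨ s(x, y) = s(0, a) ∨ s(x, y) = s(a, a+b) ∨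
      s(x, y) = s(a+b, a+b+c) ∨ s(x, y) = s(a+b+c, a+b+c+d)) := by
    have hx := hR x (by simp)
    have hy := hR y (by simp)
    simp only [Set.mem_insert_iff, Set.mem_singleton_iff] at hx hy
    rcases hx with rfl | rfl | rfl | rfl | rfl <;> rcases hy with rfl | rfl | rfl | rfl | rfl <;>
      first
      | (exfalso; linarith)
      | exact ⟨by linarith, Or.inl (by linarith)⟩
      | exact ⟨by linarith, Or.inr (by simp)⟩
  refine ⟨hmono (by simp) (by simp; linarith) key.1, ?_⟩
  rcases key.2 with h | h
  · exact Or.inl (hmono (by simp) (by simp; linarith) h)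
  · exact Or.inr h

lemma aux_key (f : ℝ → ℝ) (hmono : MonotoneOn f (Set.Ioi 0)) (hscale : ScaleInv f)
    (δ : ℝ) (hδ1 : 2 * f (1 + δ) < f 2 + f 1) (a b c d s : ℝ) (hs : 0 < s)
    (ha : a ∈ Set.Icc 1 (1 + δ)) (hb : b ∈ Set.Icc 1 (1 + δ))
    (hc : c ∈ Set.Icc 1 (1 + δ)) (hd : d ∈ Set.Icc 1 (1 + δ))
    (hba : b ≤ a) (hcd : c ≤ d) (hle : f b + f d ≤ f a + f c) :
    f (s * b) + f (s * d) ≤ f (s * a) + f (s * c) := by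
  obtain ⟨ha1, ha2⟩ := ha
  obtain ⟨hb1, hb2⟩ := hb
  obtain ⟨hc1, hc2⟩ := hc
  obtain ⟨hd1, hd2⟩ := hd
  set R : Set ℝ := {0, a, a+b, a+b+c, a+b+c+d} with hR
  have hfin : R.Finite := by simp [hR]
  have hcard : R.ncard = 5 := aux_card _ _ _ _ _ (by linarith) (by linarith) (by linarith) (by linarith)
  have hM := aux_pair f R hfin hcard a (a+b) (a+b+c) (a+b+c+d) (by simp [hR]) (by simp [hR])
    (by simp [hR]) (by simp [hR]) (by linarith) (by linarith) (by linarith)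
  have m1 : f b ≤ f a := hmono (by simp; linarith) (by simp; linarith) hba
  have m2 : f c ≤ f d := hmono (by simp; linarith) (by simp; linarith) hcd
  have m3 : f b ≤ f (1 + δ) := hmono (by simp; linarith) (by simp; linarith) hb2
  have m4 : f d ≤ f (1 + δ) := hmono (by simp; linarith) (by simp; linarith) hd2
  have la : edgeLen s(0, a) = a := by
    simp only [edgeLen, Sym2.lift_mk, Real.dist_eq]
    rw [abs_sub_comm, abs_of_pos (by linarith)]; ring
  have lb : edgeLen s(a, a+b) = b := by
    simp only [edgeLen, Sym2.lift_mk, Real.dist_eq]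
    rw [abs_sub_comm, abs_of_pos (by linarith)]; ring
  have lc : edgeLen s(a+b, a+b+c) = c := by
    simp only [edgeLen, Sym2.lift_mk, Real.dist_eq]
    rw [abs_sub_comm, abs_of_pos (by linarith)]; ring
  have ld : edgeLen s(a+b+c, a+b+c+d) = d := by
    simp only [edgeLen, Sym2.lift_mk, Real.dist_eq]
    rw [abs_sub_comm, abs_of_pos (by linarith)]; ring
  have hmin : FinMin1 f R {s(a, a+b), s(a+b+c, a+b+c+d)} := by
    refine ⟨hM.1, ?_⟩
    intro m hm
    rw [hM.2.1, hM.2.2]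
    obtain ⟨hmf, hmc⟩ := aux_count R hfin m hm
    rw [hcard] at hmc
    rcases Nat.lt_or_ge 1 (unm1 R m) with h | h
    · exact Or.inl h
    right
    have hu : unm1 R m = 1 := by omega
    refine ⟨hu.symm, ?_⟩
    obtain ⟨e, e', hne, rfl⟩ := Set.ncard_eq_two.mp (show m.ncard = 2 by omega)
    have hd' : ∀ x, x ∈ e → x ∈ e' → False := fun x h h' =>
      hne (hm.2 e (by simp) e' (by simp) x h h')
    have he := hm.1 e (by simp)
    have he' := hm.1 e' (by simp)
    rw [cost1, finsum_mem_pair hne]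
    have E := aux_edge f hmono a b c d ha1 hb1 hc1 hd1 e he.1 he.2
    have E' := aux_edge f hmono a b c d ha1 hb1 hc1 hd1 e' he'.1 he'.2
    have x1 : a + b - a = b := by ring
    have x2 : a + b + c + d - (a + b + c) = d := by ring
    rw [x1, x2]
    obtain ⟨E1, E2⟩ := E
    obtain ⟨E1', E2'⟩ := E'
    rcases E2 with h2 | h2
    · linarith
    rcases E2' with h2' | h2'
    · linarith
    rcases h2 with rfl | rfl | rfl | rfl <;> rcases h2' with rfl | rfl | rfl | rfl <;>
      simp only [la, lb, lc, ld] <;>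
      first
      | linarith
      | exact absurd rfl hne
      | exact (hd' _ (Sym2.mem_mk_left _ _) (Sym2.mem_mk_right _ _)).elim
      | exact (hd' _ (Sym2.mem_mk_right _ _) (Sym2.mem_mk_left _ _)).elim
  have hmin2 := (hscale R hfin s hs _).mp hmin
  have hR2 : (fun x => s * x) '' R = {s*0, s*a, s*(a+b), s*(a+b+c), s*(a+b+c+d)} := by
    simp only [hR, Set.image_insert_eq, Set.image_singleton]
  have hM2 : scaleM s {s(a, a+b), s(a+b+c, a+b+c+d)} =
      {s(s*a, s*(a+b)), s(s*(a+b+c), s*(a+b+c+d))} := by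
    simp only [scaleM, Set.image_pair, Sym2.map_mk]
  rw [hR2, hM2] at hmin2
  set R2 : Set ℝ := {s*0, s*a, s*(a+b), s*(a+b+c), s*(a+b+c+d)} with hR2'
  have o0 : s*0 < s*a := mul_lt_mul_of_pos_left (by linarith) hs
  have o1 : s*a < s*(a+b) := mul_lt_mul_of_pos_left (by linarith) hs
  have o2 : s*(a+b) < s*(a+b+c) := mul_lt_mul_of_pos_left (by linarith) hs
  have o3 : s*(a+b+c) < s*(a+b+c+d) := mul_lt_mul_of_pos_left (by linarith) hs
  have hfin2 : R2.Finite := by simp [hR2']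
  have hcard2 : R2.ncard = 5 := aux_card _ _ _ _ _ o0 o1 o2 o3
  have A := aux_pair f R2 hfin2 hcard2 (s*a) (s*(a+b)) (s*(a+b+c)) (s*(a+b+c+d))
    (by simp only [hR2', Set.mem_insert_iff]; tauto)
    (by simp only [hR2', Set.mem_insert_iff]; tauto)
    (by simp only [hR2', Set.mem_insert_iff]; tauto)
    (by simp only [hR2', Set.mem_insert_iff, Set.mem_singleton_iff]; tauto) o1 o2 o3
  have B := aux_pair f R2 hfin2 hcard2 (s*0) (s*a) (s*(a+b)) (s*(a+b+c))
    (by simp only [hR2', Set.mem_insert_iff]; tauto)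
    (by simp only [hR2', Set.mem_insert_iff]; tauto)
    (by simp only [hR2', Set.mem_insert_iff]; tauto)
    (by simp only [hR2', Set.mem_insert_iff]; tauto) o0 o1 o2
  have C := hmin2.2 _ B.1
  rw [A.2.1, A.2.2, B.2.1, B.2.2] at C
  have C2 : f (s * (a + b) - s * a) + f (s * (a + b + c + d) - s * (a + b + c)) ≤
      f (s * a - s * 0) + f (s * (a + b + c) - s * (a + b)) := by
    rcases C with h | h
    · omega
    · exact h.2
  have y1 : s * (a + b) - s * a = s * b := by ring
  have y2 : s * (a + b + c + d) - s * (a + b + c) = s * d := by ring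
  have y3 : s * a - s * 0 = s * a := by ring
  have y4 : s * (a + b + c) - s * (a + b) = s * c := by ring
  rwa [y1, y2, y3, y4] at C2

lemma aux_int (δ : ℝ) (hδ : 0 < δ) (x : ℝ) (hx : x ∈ Set.Icc 1 (1 + δ)) (g : ℝ → ℝ)
    (hg : ContinuousOn g (Set.Icc 1 (1 + δ))) (V : Set ℝ) (hV : IsOpen V) (hxV : g x ∈ V) :
    ∃ p q, p < q ∧ Set.Icc p q ⊆ Set.Icc 1 (1 + δ) ∧ ∀ y ∈ Set.Icc p q, g y ∈ V := by
  have h1 := (hg x hx) (hV.mem_nhds hxV)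
  rw [Filter.mem_map, Metric.mem_nhdsWithin_iff] at h1
  obtain ⟨ε, hε, h1⟩ := h1
  refine ⟨max 1 (x - ε/2), min (1 + δ) (x + ε/2), ?_, ?_, ?_⟩
  · obtain ⟨_, _⟩ := hx
    rw [max_lt_iff, lt_min_iff, lt_min_iff]
    exact ⟨⟨by linarith, by linarith⟩, by linarith, by linarith⟩
  · exact Set.Icc_subset_Icc (le_max_left _ _) (min_le_left _ _)
  · rintro y ⟨hy1, hy2⟩
    rw [max_le_iff] at hy1
    rw [le_min_iff] at hy2
    apply h1
    refine ⟨?_, hy1.1, hy2.1⟩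
    rw [Metric.mem_ball, Real.dist_eq, abs_lt]
    constructor <;> linarith [hy1.2, hy2.2]

lemma aux_main (f f' : ℝ → ℝ)
    (hderiv : ∀ x ∈ Set.Ioi (0 : ℝ), HasDerivAt f (f' x) x)
    (hcont : ContinuousOn f' (Set.Ioi 0))
    (hmono : MonotoneOn f (Set.Ioi 0))
    (hscale : ScaleInv f) (δ : ℝ) (hδ : 0 < δ)
    (hδ1 : 2 * f (1 + δ) < f 2 + f 1)
    (hδ2 : ∀ x ∈ Set.Icc (1 : ℝ) (1 + δ), 0 < f' x) :
    ∀ x ∈ Set.Icc (1 : ℝ) (1 + δ), ∀ z ∈ Set.Icc (1 : ℝ) (1 + δ), ∀ s : ℝ, 0 < s →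
      f' (s * z) / f' z ≤ f' (s * x) / f' x := by
  intro x hx z hz s hs
  by_contra! hlt
  obtain ⟨k, hk1, hk2⟩ := exists_between hlt
  have hr : ContinuousOn (fun y => f' (s * y) / f' y) (Set.Icc 1 (1 + δ)) := by
    apply ContinuousOn.div
    · apply hcont.comp (by fun_prop)
      intro y hy
      have : 0 < y := by linarith [hy.1]
      exact mul_pos hs this
    · exact hcont.mono (fun y hy => by simp only [Set.mem_Ioi]; linarith [hy.1])
    · intro y hy; exact (hδ2 y hy).ne'
  obtain ⟨p, q, hpq, hsub, hP⟩ := aux_int δ hδ x hx _ hr (Set.Iio k) isOpen_Iio hk1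
  obtain ⟨u, v, huv, hsub', hU⟩ := aux_int δ hδ z hz _ hr (Set.Ioi k) isOpen_Ioi hk2
  have hfc : ContinuousOn f (Set.Icc 1 (1 + δ)) := fun y hy =>
    (hderiv y (by simp only [Set.mem_Ioi]; linarith [hy.1])).continuousAt.continuousWithinAt
  have hFd : ∀ y ∈ Set.Icc 1 (1 + δ), HasDerivAt (fun t => f (s * t)) (s * f' (s * y)) y := by
    intro y hy
    have hy0 : 0 < y := by linarith [hy.1]
    have := (hderiv (s * y) (mul_pos hs hy0)).comp y ((hasDerivAt_id y).const_mul s)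
    simpa [mul_comm, Function.comp_def] using this
  have hfd : ∀ y ∈ Set.Icc 1 (1 + δ), HasDerivAt f (f' y) y := fun y hy =>
    hderiv y (by simp only [Set.mem_Ioi]; linarith [hy.1])
  have hst : StrictMonoOn f (Set.Icc 1 (1 + δ)) := by
    apply strictMonoOn_of_deriv_pos (convex_Icc _ _) hfc
    intro y hy
    rw [interior_Icc] at hy
    have hy' := Set.Ioo_subset_Icc_self hy
    rw [(hfd y hy').deriv]; exact hδ2 y hy'
  have hpm : p ∈ Set.Icc p q := ⟨le_rfl, hpq.le⟩
  have hqm : q ∈ Set.Icc p q := ⟨hpq.le, le_rfl⟩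
  have hum : u ∈ Set.Icc u v := ⟨le_rfl, huv.le⟩
  have hvm : v ∈ Set.Icc u v := ⟨huv.le, le_rfl⟩
  have g1 : f p < f q := hst (hsub hpm) (hsub hqm) hpq
  have g2 : f u < f v := hst (hsub' hum) (hsub' hvm) huv
  obtain ⟨η, hη, hη1, hη2⟩ : ∃ η > 0, η ≤ f q - f p ∧ η ≤ f v - f u :=
    ⟨min (f q - f p) (f v - f u), lt_min (by linarith) (by linarith), min_le_left _ _,
      min_le_right _ _⟩
  obtain ⟨a, ha, hfa⟩ := intermediate_value_Icc hpq.le (hfc.mono hsub)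
    (show f p + η ∈ Set.Icc (f p) (f q) from ⟨by linarith, by linarith⟩)
  obtain ⟨d, hd, hfd'⟩ := intermediate_value_Icc huv.le (hfc.mono hsub')
    (show f u + η ∈ Set.Icc (f u) (f v) from ⟨by linarith, by linarith⟩)
  have hpa : p < a := lt_of_le_of_ne ha.1 (by rintro rfl; linarith)
  have hud : u < d := lt_of_le_of_ne hd.1 (by rintro rfl; linarith)
  have K := aux_key f hmono hscale δ hδ1 a p u d s hs (hsub ha) (hsub hpm) (hsub' hum) (hsub' hd)
    hpa.le hud.le (by linarith)
  have mvt : ∀ l r, l < r → Set.Icc l r ⊆ Set.Icc 1 (1 + δ) → ∃ c ∈ Set.Icc l r,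
      f (s * r) - f (s * l) = (f r - f l) * s * (f' (s * c) / f' c) := by
    intro l r hlr hs1
    obtain ⟨c, hc, h⟩ := exists_ratio_hasDerivAt_eq_ratio_slope (fun t => f (s * t))
      (fun t => s * f' (s * t)) hlr
      (fun y hy => (hFd y (hs1 hy)).continuousAt.continuousWithinAt)
      (fun y hy => hFd y (hs1 (Set.Ioo_subset_Icc_self hy)))
      f f' (hfc.mono hs1) (fun y hy => hfd y (hs1 (Set.Ioo_subset_Icc_self hy)))
    have hc' := Set.Ioo_subset_Icc_self hc
    refine ⟨c, hc', ?_⟩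
    have := hδ2 c (hs1 hc')
    field_simp
    linarith
  obtain ⟨c1, hc1, e1⟩ := mvt p a hpa ((Set.Icc_subset_Icc_right ha.2).trans hsub)
  obtain ⟨c2, hc2, e2⟩ := mvt u d hud ((Set.Icc_subset_Icc_right hd.2).trans hsub')
  have r1 : f' (s * c1) / f' c1 < k := hP c1 ⟨hc1.1, hc1.2.trans ha.2⟩
  have r2 : k < f' (s * c2) / f' c2 := hU c2 ⟨hc2.1, hc2.2.trans hd.2⟩
  have i1 : f a - f p = η := by linarith
  have i2 : f d - f u = η := by linarith
  rw [i1] at e1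
  rw [i2] at e2
  have : 0 < η * s := mul_pos hη hs
  have j1 := mul_lt_mul_of_pos_left (r1.trans r2) this
  linarith

/-- With `δ` as chosen in the proof of the scale-invariance proposition,
`f'(sx)/f'(x) = f'(sz)/f'(z)` for all `x, z ∈ [1, 1+δ]` and `s > 0`. -/
theorem stmt_9 (f f' : ℝ → ℝ)
    (hderiv : ∀ x ∈ Set.Ioi (0 : ℝ), HasDerivAt f (f' x) x)
    (hcont : ContinuousOn f' (Set.Ioi 0))
    (hmono : MonotoneOn f (Set.Ioi 0))
    (hscale : ScaleInv f)
    (h1 : 0 < f' 1) (δ : ℝ) (hδ : 0 < δ)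
    (hδ1 : 2 * f (1 + δ) < f 2 + f 1)
    (hδ2 : ∀ x ∈ Set.Icc (1 : ℝ) (1 + δ), 0 < f' x) :
    ∀ x ∈ Set.Icc (1 : ℝ) (1 + δ), ∀ z ∈ Set.Icc (1 : ℝ) (1 + δ), ∀ s : ℝ, 0 < s →
      f' (s * x) / f' x = f' (s * z) / f' z := by
  intro x hx z hz s hs
  exact le_antisymm
    (aux_main f f' hderiv hcont hmono hscale δ hδ hδ1 hδ2 z hz x hx s hs)
    (aux_main f f' hderiv hcont hmono hscale δ hδ hδ1 hδ2 x hx z hz s hs)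
end

section
/- Let f : (0,∞) → ℝ be continuously differentiable and non-decreasing, with the scale-invariance property: for every finite set R ⊂ ℝ and every s > 0, a matching M is an f(·)-minimal 1-colour matching of R if and only if sM is an f(·)-minimal 1-colour matching of sR. Suppose f'(1) > 0, and that there exists δ > 0 with 2f(1+δ) < f(2) + f(1) and f'(x) > 0 for all x ∈ [1, 1+δ]. Then for all x, y, t > 0, f'(tx) · f'(y) = f'(ty) · f'(x). -/
open Set

variable {α : Type*} [MetricSpace α]

open Classical in
theorem aux_card_s11 (R : Set ℝ) (hR : R.Finite) (m : Set (Sym2 ℝ)) (hm : IsMatch1 R m) :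
    m.Finite ∧ R.ncard = 2 * m.ncard + unm1 R m := by
  have hfin : m.Finite := by
    apply (hR.toFinset.sym2.finite_toSet).subset
    intro e he
    simp only [Finset.mem_coe, Finset.mem_sym2_iff]
    intro a ha
    simpa using (hm.1 e he).2 a ha
  refine ⟨hfin, ?_⟩
  set F := hfin.toFinset with hF
  have hFm : ∀ e, e ∈ F ↔ e ∈ m := by simp [hF]
  have h1 : (F.biUnion (fun e => e.toFinset)).card = 2 * F.card := by
    rw [Finset.card_biUnion]
    · rw [Finset.sum_congr rfl (fun e he =>
        Sym2.card_toFinset_of_not_isDiag e (hm.1 e ((hFm e).1 he)).1)]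
      simp [mul_comm]
    · intro e he e' he' hne
      change Disjoint e.toFinset e'.toFinset
      rw [Finset.disjoint_left]
      intro x hx hx'
      rw [Sym2.mem_toFinset] at hx hx'
      exact hne (hm.2 e ((hFm e).1 he) e' ((hFm e').1 he') x hx hx')
  have h2 : {x ∈ R | matched1 m x} = ↑(F.biUnion (fun e => e.toFinset)) := by
    ext x
    simp only [Set.mem_setOf_eq, Finset.mem_coe, Finset.mem_biUnion, Sym2.mem_toFinset, hFm]
    constructor
    · rintro ⟨_, e, he, hx⟩
      exact ⟨e, he, hx⟩
    · rintro ⟨e, he, hx⟩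
      exact ⟨(hm.1 e he).2 x hx, e, he, hx⟩
  have h3 : R = {x ∈ R | matched1 m x} ∪ {x ∈ R | ¬ matched1 m x} := by
    ext x
    simp only [Set.mem_union, Set.mem_setOf_eq]
    tauto
  have h4 : R.ncard = {x ∈ R | matched1 m x}.ncard + {x ∈ R | ¬ matched1 m x}.ncard := by
    conv_lhs => rw [h3]
    apply Set.ncard_union_eq
    · rw [Set.disjoint_left]
      rintro x ⟨_, h⟩ ⟨_, h'⟩
      exact h' h
    · exact hR.subset (fun x hx => hx.1)
    · exact hR.subset (fun x hx => hx.1)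
  rw [h4, h2, Set.ncard_coe_finset, h1, ← Set.ncard_coe_finset F]
  simp [hF, unm1]

theorem aux_cost (f : ℝ → ℝ) (a b c d : ℝ) (h : s(a, b) ≠ s(c, d)) :
    cost1 f {s(a, b), s(c, d)} = f |a - b| + f |c - d| := by
  unfold cost1
  rw [finsum_mem_pair h]
  simp [edgeLen, Real.dist_eq]

theorem aux_pair_match (R : Set ℝ) (a b c d : ℝ) (ha : a ∈ R) (hb : b ∈ R) (hc : c ∈ R)
    (hd : d ∈ R) (hab : a < b) (hbc : b < c) (hcd : c < d) :
    IsMatch1 R {s(a, b), s(c, d)} := by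
  constructor
  · intro e he
    rcases he with rfl | rfl
    · simp [hab.ne, ha, hb]
    · simp [hcd.ne, hc, hd]
  · intro e he e' he' x hx hx'
    rcases he with rfl | rfl <;> rcases he' with rfl | rfl
    · rfl
    · simp only [Sym2.mem_iff] at hx hx'
      rcases hx with rfl | rfl <;> rcases hx' with rfl | rfl <;> linarith
    · simp only [Sym2.mem_iff] at hx hx'
      rcases hx with rfl | rfl <;> rcases hx' with rfl | rfl <;> linarith
    · rfl

theorem aux_ne (a b c d : ℝ) (hab : a < b) (hbc : b < c) (hcd : c < d) :
    s(a, b) ≠ s(c, d) := by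
  intro h
  rw [Sym2.eq_iff] at h
  rcases h with ⟨h, h'⟩ | ⟨h, h'⟩ <;> linarith

theorem aux_edge_s11 (p0 p1 p2 p3 p4 u v : ℝ) (h0 : p0 + 1 ≤ p1) (h1 : p1 + 1 ≤ p2)
    (h2 : p2 + 1 ≤ p3) (h3 : p3 + 1 ≤ p4)
    (hu : u ∈ ({p0, p1, p2, p3, p4} : Set ℝ)) (hv : v ∈ ({p0, p1, p2, p3, p4} : Set ℝ))
    (huv : u < v) :
    2 ≤ v - u ∨ (u = p0 ∧ v = p1) ∨ (u = p1 ∧ v = p2) ∨ (u = p2 ∧ v = p3) ∨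
      (u = p3 ∧ v = p4) := by
  simp only [Set.mem_insert_iff, Set.mem_singleton_iff] at hu hv
  rcases hu with rfl | rfl | rfl | rfl | rfl <;> rcases hv with rfl | rfl | rfl | rfl | rfl <;>
    first
    | (exfalso; linarith)
    | (left; linarith)
    | simp

theorem aux_gap (p0 p1 p2 p3 p4 u v : ℝ) (h0 : p0 + 1 ≤ p1) (h1 : p1 + 1 ≤ p2)
    (h2 : p2 + 1 ≤ p3) (h3 : p3 + 1 ≤ p4)
    (hu : u ∈ ({p0, p1, p2, p3, p4} : Set ℝ)) (hv : v ∈ ({p0, p1, p2, p3, p4} : Set ℝ))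
    (huv : u < v) : 1 ≤ v - u := by
  rcases aux_edge_s11 p0 p1 p2 p3 p4 u v h0 h1 h2 h3 hu hv huv with
    h | ⟨rfl, rfl⟩ | ⟨rfl, rfl⟩ | ⟨rfl, rfl⟩ | ⟨rfl, rfl⟩ <;> linarith

theorem aux_lt (e : Sym2 ℝ) (h : ¬ e.IsDiag) : ∃ u v, u < v ∧ e = s(u, v) := by
  induction e using Sym2.ind with
  | _ a b =>
    have : a ≠ b := by simpa using h
    rcases lt_or_gt_of_ne this with h | h
    · exact ⟨a, b, h, rfl⟩
    · exact ⟨b, a, h, Sym2.eq_swap⟩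

/-- any matching of the five points with exactly one unmatched point costs at least `V`. -/
theorem aux_lower (f : ℝ → ℝ) (hmono : MonotoneOn f (Set.Ioi 0)) (p0 p1 p2 p3 p4 V : ℝ)
    (h0 : p0 + 1 ≤ p1) (h1 : p1 + 1 ≤ p2) (h2 : p2 + 1 ≤ p3) (h3 : p3 + 1 ≤ p4)
    (hV : V ≤ f 2 + f 1) (hac : V ≤ f (p1 - p0) + f (p3 - p2))
    (had : V ≤ f (p1 - p0) + f (p4 - p3)) (hbd : V ≤ f (p2 - p1) + f (p4 - p3))
    (m : Set (Sym2 ℝ)) (hm : IsMatch1 {p0, p1, p2, p3, p4} m) (hc : m.ncard = 2) :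
    V ≤ cost1 f m := by
  obtain ⟨e, e', hne, rfl⟩ := Set.ncard_eq_two.1 hc
  have he := hm.1 e (by simp)
  have he' := hm.1 e' (by simp)
  have hdis : ∀ x, x ∈ e → x ∈ e' → False := fun x hx hx' =>
    hne (hm.2 e (by simp) e' (by simp) x hx hx')
  obtain ⟨u, v, huv, rfl⟩ := aux_lt e he.1
  obtain ⟨w, z, hwz, rfl⟩ := aux_lt e' he'.1
  rw [aux_cost f _ _ _ _ hne, abs_sub_comm u, abs_sub_comm w, abs_of_pos (sub_pos.2 huv),
    abs_of_pos (sub_pos.2 hwz)]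
  have hu := he.2 u (by simp)
  have hv := he.2 v (by simp)
  have hw := he'.2 w (by simp)
  have hz := he'.2 z (by simp)
  have g1 := aux_gap p0 p1 p2 p3 p4 u v h0 h1 h2 h3 hu hv huv
  have g2 := aux_gap p0 p1 p2 p3 p4 w z h0 h1 h2 h3 hw hz hwz
  have f1 : f 1 ≤ f (v - u) := hmono (by simp) (by simp [huv]) g1
  have f2 : f 1 ≤ f (z - w) := hmono (by simp) (by simp [hwz]) g2
  have d1 := hdis u (by simp)
  have d2 := hdis v (by simp)
  simp only [Sym2.mem_iff] at d1 d2
  rcases aux_edge_s11 p0 p1 p2 p3 p4 u v h0 h1 h2 h3 hu hv huv with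
    h | h
  · have := hmono (by simp) (by simp [huv]) h
    linarith
  rcases aux_edge_s11 p0 p1 p2 p3 p4 w z h0 h1 h2 h3 hw hz hwz with
    h' | h'
  · have := hmono (by simp) (by simp [hwz]) h'
    linarith
  clear hdis he he' hm hc hne hu hv hw hz g1 g2 f1 f2 
  rcases h with ⟨rfl, rfl⟩ | ⟨rfl, rfl⟩ | ⟨rfl, rfl⟩ | ⟨rfl, rfl⟩ <;>
  rcases h' with ⟨h5, h6⟩ | ⟨h5, h6⟩ | ⟨h5, h6⟩ | ⟨h5, h6⟩ <;>
  first
  | (exfalso; apply d1; left; linarith)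
  | (exfalso; apply d1; right; linarith)
  | (exfalso; apply d2; left; linarith)
  | (exfalso; apply d2; right; linarith)
  | (rw [h5, h6]; linarith)

theorem aux_min (f : ℝ → ℝ) (hmono : MonotoneOn f (Set.Ioi 0)) (p0 p1 p2 p3 p4 V : ℝ)
    (h0 : p0 + 1 ≤ p1) (h1 : p1 + 1 ≤ p2) (h2 : p2 + 1 ≤ p3) (h3 : p3 + 1 ≤ p4)
    (hV : V ≤ f 2 + f 1) (hac : V ≤ f (p1 - p0) + f (p3 - p2))
    (had : V ≤ f (p1 - p0) + f (p4 - p3)) (hbd : V ≤ f (p2 - p1) + f (p4 - p3))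
    (M : Set (Sym2 ℝ)) (hM : IsMatch1 {p0, p1, p2, p3, p4} M) (hc : M.ncard = 2)
    (hcost : cost1 f M = V) : FinMin1 f {p0, p1, p2, p3, p4} M := by
  have hR : ({p0, p1, p2, p3, p4} : Set ℝ).Finite := by simp
  have hcard : ({p0, p1, p2, p3, p4} : Set ℝ).ncard = 5 := by
    rw [Set.ncard_insert_of_notMem, Set.ncard_insert_of_notMem, Set.ncard_insert_of_notMem,
      Set.ncard_pair]
    · linarith
    all_goals
      simp only [Set.mem_insert_iff, Set.mem_singleton_iff, not_or]
      refine ⟨?_, ?_⟩ <;> first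
        | (intro h; linarith)
        | (refine ⟨?_, ?_⟩ <;> first
            | (intro h; linarith)
            | (refine ⟨?_, ?_⟩ <;> (intro h; linarith)))
  refine ⟨hM, fun m hm => ?_⟩
  have c1 := (aux_card_s11 _ hR M hM).2
  have c2 := (aux_card_s11 _ hR m hm).2
  rw [hcard] at c1 c2
  by_cases h : m.ncard = 2
  · right
    refine ⟨by omega, ?_⟩
    rw [hcost]
    exact aux_lower f hmono p0 p1 p2 p3 p4 V h0 h1 h2 h3 hV hac had hbd m hm h
  · left
    omega

theorem aux_eq (f : ℝ → ℝ) (hmono : MonotoneOn f (Set.Ioi 0)) (hscale : ScaleInv f)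
    (a b c d t : ℝ) (ht : 0 < t) (ha : 1 ≤ a) (hb : 1 ≤ b) (hc : 1 ≤ c) (hd : 1 ≤ d)
    (hba : b ≤ a)
    (heq : f a + f c = f b + f d) (hV : f a + f c ≤ f 2 + f 1) :
    f (t * a) + f (t * c) = f (t * b) + f (t * d) := by
  have hfba : f b ≤ f a := hmono (by simp; linarith) (by simp; linarith) hba
  set p2 := a + b with hp2
  set p3 := a + b + c with hp3
  set p4 := a + b + c + d with hp4
  have e1 : a - 0 = a := by ring
  have e2 : p2 - a = b := by rw [hp2]; ring
  have e3 : p3 - p2 = c := by rw [hp2, hp3]; ring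
  have e4 : p4 - p3 = d := by rw [hp3, hp4]; ring
  have n1 : s(0, a) ≠ s(p2, p3) := aux_ne _ _ _ _ (by linarith) (by linarith) (by linarith)
  have n2 : s(a, p2) ≠ s(p3, p4) := aux_ne _ _ _ _ (by linarith) (by linarith) (by linarith)
  have m1 : FinMin1 f {0, a, p2, p3, p4} {s(0, a), s(p2, p3)} := by
    apply aux_min f hmono 0 a p2 p3 p4 (f a + f c) (by linarith) (by linarith) (by linarith)
      (by linarith) hV
    · rw [e1, e3]
    · rw [e1, e4]; linarith
    · rw [e2, e4]; linarith
    · apply aux_pair_match <;> first | linarith | simp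
    · exact Set.ncard_pair n1
    · rw [aux_cost _ _ _ _ _ n1, abs_sub_comm, abs_sub_comm p2, e1, e3, abs_of_pos (by linarith),
        abs_of_pos (by linarith)]
  have m2 : FinMin1 f {0, a, p2, p3, p4} {s(a, p2), s(p3, p4)} := by
    apply aux_min f hmono 0 a p2 p3 p4 (f a + f c) (by linarith) (by linarith) (by linarith)
      (by linarith) hV
    · rw [e1, e3]
    · rw [e1, e4]; linarith
    · rw [e2, e4]; linarith
    · apply aux_pair_match <;> first | linarith | simp
    · exact Set.ncard_pair n2
    · rw [aux_cost _ _ _ _ _ n2, abs_sub_comm, abs_sub_comm p3, e2, e4, abs_of_pos (by linarith),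
        abs_of_pos (by linarith), heq]
  have hR : ({0, a, p2, p3, p4} : Set ℝ).Finite := by simp
  have s1 := (hscale _ hR t ht _).1 m1
  have s2 := (hscale _ hR t ht _).1 m2
  have key : ∀ u c u' c', lexLe u c u' c' → lexLe u' c' u c → c = c' := by
    intro u c u' c' h h'
    rcases h with h | ⟨h, h2⟩ <;> rcases h' with h' | ⟨h', h2'⟩
    · omega
    · omega
    · omega
    · linarith
  have := key _ _ _ _ (s1.2 _ s2.1) (s2.2 _ s1.1)
  have k0 : t * 0 < t * a := by gcongr; linarith
  have k1 : t * a < t * p2 := by gcongr; linarith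
  have k2 : t * p2 < t * p3 := by gcongr; linarith
  have k3 : t * p3 < t * p4 := by gcongr; linarith
  simp only [scaleM, Set.image_pair, Sym2.map_mk] at this
  rw [aux_cost, aux_cost, abs_sub_comm (t * 0), abs_sub_comm (t * p2) (t * p3),
    abs_sub_comm (t * a) (t * p2), abs_sub_comm (t * p3) (t * p4), abs_of_pos (by linarith), abs_of_pos (by linarith),
    abs_of_pos (by linarith), abs_of_pos (by linarith), ← mul_sub, ← mul_sub, ← mul_sub,
    ← mul_sub, e1, e2, e3, e4] at this
  · exact this
  · exact aux_ne _ _ _ _ k1 k2 k3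
  · exact aux_ne _ _ _ _ k0 k1 k2

theorem aux_local (f f' : ℝ → ℝ)
    (hderiv : ∀ x ∈ Set.Ioi (0 : ℝ), HasDerivAt f (f' x) x)
    (hmono : MonotoneOn f (Set.Ioi 0))
    (hscale : ScaleInv f) (δ : ℝ) (hV : 2 * f (1 + δ) < f 2 + f 1)
    (hpos : ∀ x ∈ Set.Icc (1 : ℝ) (1 + δ), 0 < f' x)
    (x y t : ℝ) (hx : 1 ≤ x) (hy : 1 ≤ y) (ht : 0 < t) (e : ℝ) (he : 0 < e)
    (hxe : x + e ≤ 1 + δ) (hye : y + e ≤ 1 + δ) :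
    ∃ c ∈ Set.Ioo x (x + e), ∃ d ∈ Set.Ioo y (y + e),
      f' (t * c) * f' d = f' (t * d) * f' c := by
  have hcf : ContinuousOn f (Set.Ioi 0) := fun z hz =>
    (hderiv z hz).continuousAt.continuousWithinAt
  have hstr : StrictMonoOn f (Set.Icc 1 (1 + δ)) := by
    apply strictMonoOn_of_deriv_pos (convex_Icc _ _)
    · exact hcf.mono (fun z hz => by simp at hz ⊢; linarith)
    · intro z hz
      rw [interior_Icc] at hz
      rw [(hderiv z (by simp at hz ⊢; linarith)).deriv]
      exact hpos z ⟨hz.1.le, hz.2.le⟩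
  have hfx : f x < f (x + e) := hstr ⟨hx, by linarith⟩ ⟨by linarith, hxe⟩ (by linarith)
  have hfy : f y < f (y + e) := hstr ⟨hy, by linarith⟩ ⟨by linarith, hye⟩ (by linarith)
  obtain ⟨v, hv, hvx, hvy⟩ : ∃ v, 0 < v ∧ v ≤ f (x + e) - f x ∧ v ≤ f (y + e) - f y :=
    ⟨min (f (x + e) - f x) (f (y + e) - f y), lt_min (by linarith) (by linarith),
      min_le_left _ _, min_le_right _ _⟩
  have ivt : ∀ z, 1 ≤ z → v ≤ f (z + e) - f z → ∃ w, z < w ∧ w ≤ z + e ∧ f w = f z + v := by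
    intro z hz hvz
    have := intermediate_value_Icc (show z ≤ z + e by linarith)
      (hcf.mono (fun u hu => by simp at hu ⊢; linarith))
    obtain ⟨w, hw, hfw⟩ := this (show f z + v ∈ Set.Icc (f z) (f (z + e)) from
      ⟨by linarith, by linarith⟩)
    refine ⟨w, lt_of_le_of_ne hw.1 ?_, hw.2, hfw⟩
    rintro rfl
    linarith
  obtain ⟨X, hX, hXe, hfX⟩ := ivt x hx hvx
  obtain ⟨Y, hY, hYe, hfY⟩ := ivt y hy hvy
  have main := aux_eq f hmono hscale X x y Y t ht (by linarith) hx hy (by linarith) hX.le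
    (by linarith) (by
      have b1 : f X ≤ f (1 + δ) := hmono (by simp; linarith) (by simp; linarith) (by linarith)
      have b2 : f y ≤ f (1 + δ) := hmono (by simp; linarith) (by simp; linarith) (by linarith)
      linarith)
  have mvt : ∀ z Z, 1 ≤ z → z < Z → ∃ c ∈ Set.Ioo z Z,
      (f (t * Z) - f (t * z)) * f' c = (f Z - f z) * (f' (t * c) * t) := by
    intro z Z hz hzZ
    have hd : ∀ u, 0 < u → HasDerivAt (fun u => f (t * u)) (f' (t * u) * t) u := by
      intro u hu
      have h1 : HasDerivAt (fun u : ℝ => t * u) t u := by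
        simpa using (hasDerivAt_id u).const_mul t
      exact (hderiv (t * u) (mul_pos ht hu)).comp u h1
    exact exists_ratio_hasDerivAt_eq_ratio_slope f f' hzZ
      (hcf.mono (fun u hu => by simp at hu ⊢; linarith))
      (fun u hu => hderiv u (by simp at hu ⊢; linarith))
      (fun u => f (t * u)) (fun u => f' (t * u) * t)
      (fun u hu => (hd u (by simp at hu; linarith)).continuousAt.continuousWithinAt)
      (fun u hu => hd u (by simp at hu; linarith))
  obtain ⟨c, hc, hc'⟩ := mvt x X hx hX
  obtain ⟨d, hd, hd'⟩ := mvt y Y hy hY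
  refine ⟨c, ⟨hc.1, by linarith [hc.2]⟩, d, ⟨hd.1, by linarith [hd.2]⟩, ?_⟩
  have q1 : f X - f x = v := by linarith
  have q2 : f Y - f y = v := by linarith
  have q3 : f (t * Y) - f (t * y) = f (t * X) - f (t * x) := by linarith
  rw [q1] at hc'
  rw [q2, q3] at hd'
  apply mul_left_cancel₀ (mul_pos hv ht).ne'
  linear_combination f' c * hd' - f' d * hc'

theorem aux_near (f f' : ℝ → ℝ)
    (hderiv : ∀ x ∈ Set.Ioi (0 : ℝ), HasDerivAt f (f' x) x)
    (hcont : ContinuousOn f' (Set.Ioi 0))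
    (hmono : MonotoneOn f (Set.Ioi 0))
    (hscale : ScaleInv f) (δ : ℝ) (hV : 2 * f (1 + δ) < f 2 + f 1)
    (hpos : ∀ x ∈ Set.Icc (1 : ℝ) (1 + δ), 0 < f' x)
    (x y t : ℝ) (hx : 1 ≤ x) (hy : 1 ≤ y) (ht : 0 < t)
    (hxe : x < 1 + δ) (hye : y < 1 + δ) :
    f' (t * x) * f' y = f' (t * y) * f' x := by
  have hex : ∀ n : ℕ, ∃ c d : ℝ, (x < c ∧ c < x + 1 / ((n : ℝ) + 1)) ∧
      (y < d ∧ d < y + 1 / ((n : ℝ) + 1)) ∧ f' (t * c) * f' d = f' (t * d) * f' c := by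
    intro n
    have hn : (0 : ℝ) < 1 / ((n : ℝ) + 1) := by positivity
    obtain ⟨e, he, h1, h2, h3⟩ : ∃ e, 0 < e ∧ e ≤ 1 / ((n : ℝ) + 1) ∧ x + e ≤ 1 + δ ∧
        y + e ≤ 1 + δ := by
      refine ⟨min (1 / ((n : ℝ) + 1)) (min (1 + δ - x) (1 + δ - y)),
        lt_min hn (lt_min (by linarith) (by linarith)), min_le_left _ _, ?_, ?_⟩
      · have := (min_le_right (1 / ((n : ℝ) + 1)) (min (1 + δ - x) (1 + δ - y))).trans
          (min_le_left _ _)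
        linarith
      · have := (min_le_right (1 / ((n : ℝ) + 1)) (min (1 + δ - x) (1 + δ - y))).trans
          (min_le_right _ _)
        linarith
    obtain ⟨c, hc, d, hd, h⟩ := aux_local f f' hderiv hmono hscale δ hV hpos x y t hx hy ht e he
      h2 h3
    exact ⟨c, d, ⟨hc.1, by linarith [hc.2]⟩, ⟨hd.1, by linarith [hd.2]⟩, h⟩
  choose c d hc hd h using hex
  have lim : ∀ z : ℝ, Filter.Tendsto (fun n : ℕ => z + 1 / ((n : ℝ) + 1)) Filter.atTop
      (nhds z) := by
    intro z
    simpa using tendsto_one_div_add_atTop_nhds_zero_nat.const_add z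
  have tc : Filter.Tendsto c Filter.atTop (nhds x) :=
    tendsto_of_tendsto_of_tendsto_of_le_of_le tendsto_const_nhds (lim x)
      (fun n => (hc n).1.le) (fun n => (hc n).2.le)
  have td : Filter.Tendsto d Filter.atTop (nhds y) :=
    tendsto_of_tendsto_of_tendsto_of_le_of_le tendsto_const_nhds (lim y)
      (fun n => (hd n).1.le) (fun n => (hd n).2.le)
  have cat : ∀ z : ℝ, 0 < z → Filter.Tendsto f' (nhds z) (nhds (f' z)) := fun z hz =>
    hcont.continuousAt (Ioi_mem_nhds hz)
  have hx0 : 0 < x := by linarith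
  have hy0 : 0 < y := by linarith
  have l1 := ((cat (t * x) (mul_pos ht hx0)).comp (tc.const_mul t)).mul ((cat y hy0).comp td)
  have l2 := ((cat (t * y) (mul_pos ht hy0)).comp (td.const_mul t)).mul ((cat x hx0).comp tc)
  refine tendsto_nhds_unique l1 (l2.congr (fun n => ?_))
  exact (h n).symm

/-- Under the hypotheses of the scale-invariance proposition,
`f'(tx) f'(y) = f'(ty) f'(x)` for all `x, y, t > 0`. -/
theorem stmt_11 (f f' : ℝ → ℝ)
    (hderiv : ∀ x ∈ Set.Ioi (0 : ℝ), HasDerivAt f (f' x) x)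
    (hcont : ContinuousOn f' (Set.Ioi 0))
    (hmono : MonotoneOn f (Set.Ioi 0))
    (hscale : ScaleInv f)
    (h1 : 0 < f' 1)
    (hδ : ∃ δ : ℝ, 0 < δ ∧ 2 * f (1 + δ) < f 2 + f 1 ∧
      ∀ x ∈ Set.Icc (1 : ℝ) (1 + δ), 0 < f' x) :
    ∀ x y t : ℝ, 0 < x → 0 < y → 0 < t → f' (t * x) * f' y = f' (t * y) * f' x := by
  obtain ⟨δ, hδ0, hV, hpos⟩ := hδ
  have near : ∀ y t : ℝ, 0 < t → 1 ≤ y → y < 1 + δ → f' (t * y) * f' 1 = f' t * f' y := by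
    intro y t ht hy hyd
    have := aux_near f f' hderiv hcont hmono hscale δ hV hpos 1 y t le_rfl hy ht (by linarith) hyd
    rw [mul_one] at this
    exact this.symm
  have ge1 : ∀ y t : ℝ, 0 < t → 1 ≤ y → f' (t * y) * f' 1 = f' t * f' y := by
    intro y t ht hy
    obtain ⟨n, hn⟩ := pow_unbounded_of_one_lt y (show 1 < 1 + δ by linarith)
    have hn0 : n ≠ 0 := by
      rintro rfl
      simp at hn
      linarith
    have hy0 : 0 ≤ y := by linarith
    obtain ⟨r, hr⟩ : ∃ r, r = y ^ ((n : ℝ)⁻¹) := ⟨_, rfl⟩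
    have hrn : r ^ n = y := by rw [hr]; exact Real.rpow_inv_natCast_pow hy0 hn0
    have hr1 : 1 ≤ r := by rw [hr]; exact Real.one_le_rpow hy (by positivity)
    have hrd : r < 1 + δ := by
      apply lt_of_pow_lt_pow_left₀ n (by linarith)
      rw [hrn]; exact hn
    have hr0 : 0 < r := by linarith
    have ind : ∀ k : ℕ, ∀ t : ℝ, 0 < t → f' (t * r ^ k) * f' 1 = f' t * f' (r ^ k) := by
      intro k
      induction k with
      | zero => intro t _; simp
      | succ k ih =>
        intro t ht
        have a1 := near r (t * r ^ k) (by positivity) hr1 hrd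
        have a2 := near r (r ^ k) (by positivity) hr1 hrd
        have a3 := ih t ht
        rw [pow_succ, ← mul_assoc]
        apply mul_right_cancel₀ h1.ne'
        linear_combination f' 1 * a1 + f' r * a3 - f' t * a2
    rw [← hrn]
    exact ind n t ht
  have all : ∀ y t : ℝ, 0 < t → 0 < y → f' (t * y) * f' 1 = f' t * f' y := by
    intro y t ht hy
    rcases le_total 1 y with h | h
    · exact ge1 y t ht h
    · have hz : 1 ≤ y⁻¹ := (one_le_inv₀ hy).2 h
      have b1 := ge1 y⁻¹ y hy hz
      have b2 := ge1 y⁻¹ (t * y) (by positivity) hz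
      rw [mul_inv_cancel₀ hy.ne'] at b1
      rw [mul_assoc, mul_inv_cancel₀ hy.ne', mul_one] at b2
      apply mul_right_cancel₀ h1.ne'
      linear_combination f' (t * y) * b1 - f' y * b2
  intro x y t hx hy ht
  have c1 := all x t ht hx
  have c2 := all y t ht hy
  apply mul_right_cancel₀ h1.ne'
  linear_combination f' y * c1 - f' x * c2
end

section
/- Fix γ ∈ ℝ with γ < 1. There exists κ = κ(γ) ∈ [1, ∞) with the following property: for every d ≥ 1, if M is a γ-minimal 1-colour matching of a set R ⊆ ℝ^d and x, y ∈ R are distinct points, then min(|x − M(x)|, |y − M(y)|) ≤ κ|x − y|, where |x − M(x)| := ∞ if x is unmatched. The same holds for a γ-minimal 2-colour matching of disjoint R, B ⊆ ℝ^d provided x ∈ R and y ∈ B. -/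
open Set

variable {α : Type*} [MetricSpace α]

lemma fgam_strictMono (γ : ℝ) {x y : ℝ} (hx : 0 < x) (hxy : x < y) : fgam γ x < fgam γ y := by
  unfold fgam
  split_ifs with h1 h2
  · exact Real.rpow_lt_rpow hx.le hxy h1
  · exact Real.log_lt_log hx hxy
  · have := Real.rpow_lt_rpow_of_neg hx hxy (lt_of_le_of_ne (not_lt.1 h1) h2)
    linarith

lemma fgam_mono (γ : ℝ) {x y : ℝ} (hx : 0 < x) (hxy : x ≤ y) : fgam γ x ≤ fgam γ y := by
  rcases hxy.eq_or_lt with rfl | h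
  · exact le_rfl
  · exact (fgam_strictMono γ hx h).le

lemma key_pos (γ : ℝ) (h0 : 0 < γ) (h1 : γ < 1) : ∃ κ : ℝ, 1 ≤ κ ∧ ∀ r a b : ℝ, 0 < r →
    κ * r < a → a ≤ b → r ^ γ + (a + b + r) ^ γ < a ^ γ + b ^ γ := by
  have hc : ContinuousAt (fun t : ℝ => (2 + t) ^ γ + t ^ γ) 0 := by
    refine ContinuousAt.add ?_ ?_
    · exact ContinuousAt.rpow_const (by fun_prop) (Or.inr h0.le)
    · exact ContinuousAt.rpow_const (by fun_prop) (Or.inr h0.le)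
  have h2 : (2 + (0:ℝ)) ^ γ + (0:ℝ) ^ γ < 2 := by
    rw [Real.zero_rpow h0.ne', add_zero, add_zero]
    calc (2:ℝ) ^ γ < 2 ^ (1:ℝ) := Real.rpow_lt_rpow_of_exponent_lt (by norm_num) h1
      _ = 2 := by norm_num
  have hev := hc.eventually_lt (continuousAt_const (y := (2:ℝ))) h2
  obtain ⟨ε, hε, H⟩ := Metric.eventually_nhds_iff.1 hev
  refine ⟨max 1 (1 / ε), le_max_left _ _, ?_⟩
  intro r a b hr ha hab
  have hεr : 1 / ε * r < a := lt_of_le_of_lt (by gcongr; exact le_max_right _ _) ha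
  have ha0 : 0 < a := lt_trans (by positivity) hεr
  have hb0 : 0 < b := lt_of_lt_of_le ha0 hab
  have ht : r / a < ε := by
    rw [div_lt_iff₀ ha0]
    rw [div_mul_eq_mul_div, one_mul, div_lt_iff₀ hε] at hεr
    linarith
  have hH := H (y := r / a) (by rw [Real.dist_eq, sub_zero, abs_of_pos (by positivity)]; exact ht)
  have e1 : (2 + r / a) ^ γ * a ^ γ = (2 * a + r) ^ γ := by
    rw [← Real.mul_rpow (by positivity) ha0.le]; congr 1; field_simp
  have e2 : (r / a) ^ γ * a ^ γ = r ^ γ := by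
    rw [← Real.mul_rpow (by positivity) ha0.le]; congr 1; field_simp
  have haγ : 0 < a ^ γ := Real.rpow_pos_of_pos ha0 γ
  have h3 : (2 * a + r) ^ γ + r ^ γ < 2 * a ^ γ := by
    rw [← e1, ← e2, ← add_mul]
    exact mul_lt_mul_of_pos_right hH haγ
  have hcv := Real.concaveOn_rpow h0.le h1.le
  have hbr : 0 < b + r := by positivity
  have p1 : 0 ≤ (a + r) / (b + r) := by positivity
  have p2 : 0 ≤ (b - a) / (b + r) := div_nonneg (by linarith) hbr.le
  have p3 : (a + r) / (b + r) + (b - a) / (b + r) = 1 := by field_simp; ring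
  have q1 := hcv.2 (x := a) (y := a + b + r) ha0.le (by simp; positivity) p1 p2 p3
  have q2 := hcv.2 (x := a) (y := a + b + r) ha0.le (by simp; positivity) p2 p1 (by linarith)
  simp only [smul_eq_mul] at q1 q2
  have r1 : (a + r) / (b + r) * a + (b - a) / (b + r) * (a + b + r) = b := by
    field_simp; ring
  have r2 : (b - a) / (b + r) * a + (a + r) / (b + r) * (a + b + r) = 2 * a + r := by
    field_simp; ring
  rw [r1] at q1
  rw [r2] at q2
  have : a ^ γ + (a + b + r) ^ γ ≤ b ^ γ + (2 * a + r) ^ γ := by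
    calc a ^ γ + (a + b + r) ^ γ =
        ((a + r) / (b + r) + (b - a) / (b + r)) * (a ^ γ + (a + b + r) ^ γ) := by rw [p3, one_mul]
      _ ≤ _ := by linarith
  linarith

lemma key (γ : ℝ) (hγ : γ < 1) : ∃ κ : ℝ, 1 ≤ κ ∧ ∀ r a b : ℝ, 0 < r →
    κ * r < a → κ * r < b → fgam γ r + fgam γ (a + b + r) < fgam γ a + fgam γ b := by
  rcases lt_trichotomy γ 0 with h | h | h
  · refine ⟨2 ^ (-1 / γ), Real.one_le_rpow (by norm_num)
      (div_nonneg_of_nonpos (by norm_num) h.le), ?_⟩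
    intro r a b hr ha hb
    have hk : (0:ℝ) < 2 ^ (-1 / γ) * r := by positivity
    have e : ((2:ℝ) ^ (-1 / γ) * r) ^ γ = r ^ γ / 2 := by
      rw [Real.mul_rpow (by positivity) hr.le, ← Real.rpow_mul (by norm_num)]
      rw [div_mul_cancel₀ _ h.ne, Real.rpow_neg_one]; ring
    have h1 := Real.rpow_lt_rpow_of_neg hk ha h
    have h2 := Real.rpow_lt_rpow_of_neg hk hb h
    have h3 : 0 < (a + b + r) ^ γ := Real.rpow_pos_of_pos (by linarith) γ
    rw [e] at h1 h2
    simp only [fgam, not_lt.2 h.le, h.ne, if_false]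
    linarith
  · subst h
    refine ⟨3, by norm_num, ?_⟩
    intro r a b hr ha hb
    simp only [fgam, lt_irrefl, if_false, if_true]
    have ha0 : 0 < a := by linarith
    have hb0 : 0 < b := by linarith
    rw [← Real.log_mul (by positivity) (by positivity), ← Real.log_mul (by positivity) (by positivity)]
    apply Real.log_lt_log (by positivity)
    nlinarith [mul_pos (sub_pos.2 ha) (sub_pos.2 hb), mul_pos hr (sub_pos.2 ha), mul_pos hr (sub_pos.2 hb), mul_pos hr hr, mul_pos ha0 (sub_pos.2 hb), mul_pos hb0 (sub_pos.2 ha)]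
  · obtain ⟨κ, hκ, H⟩ := key_pos γ h hγ
    refine ⟨κ, hκ, ?_⟩
    intro r a b hr ha hb
    simp only [fgam, h, if_true]
    rcases le_total a b with hab | hab
    · exact H r a b hr ha hab
    · have := H r b a hr hb hab
      rw [add_comm b a] at this
      linarith

section
variable {α : Type*} [MetricSpace α]

lemma unm1_lt_absurd {R : Set α} {M : Set (Sym2 α)} (hR : R.Finite) {x : α} (hx : x ∈ R)
    (hm : ¬ matched1 M x) : 0 < unm1 R M :=
  (Set.ncard_pos (hR.subset (Set.sep_subset _ _))).2 ⟨x, hx, hm⟩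

lemma one_none {f : ℝ → ℝ} {R : Set α} {M : Set (Sym2 α)} (h : Min1 f R M) {x y : α}
    (hx : x ∈ R) (hy : y ∈ R) (hxy : x ≠ y) (hmx : ¬ matched1 M x) (hmy : ¬ matched1 M y) :
    False := by
  have hf : ({x, y} : Set α).Finite := by simp
  have H := h.2 {x, y} (by grind) hf (by
    rintro e he ⟨z, hz, hz'⟩
    rcases hz' with rfl | rfl
    · exact absurd ⟨e, he, hz⟩ hmx
    · exact absurd ⟨e, he, hz⟩ hmy)
  have hm : IsMatch1 {x, y} {s(x, y)} := by
    refine ⟨?_, ?_⟩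
    · rintro e rfl
      simp [hxy]
    · rintro e rfl e' rfl z _ _; rfl
  have h0 : unm1 {x, y} {s(x, y)} = 0 := by
    have : {z ∈ ({x, y} : Set α) | ¬ matched1 {s(x, y)} z} = ∅ := by
      ext z; simp [matched1]; tauto
    rw [unm1, this, Set.ncard_empty]
  have hp := unm1_lt_absurd (M := restr1 M {x, y}) hf (x := x) (by simp)
    (fun ⟨e, he, hz⟩ => hmx ⟨e, he.1, hz⟩)
  rcases H.2 _ hm with h1 | h1 <;> omega

lemma one_half {f : ℝ → ℝ} {R : Set α} {M : Set (Sym2 α)} (h : Min1 f R M) {x y u : α}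
    (hx : x ∈ R) (hy : y ∈ R) (hxy : x ≠ y) (hmx : s(x, u) ∈ M) (hmy : ¬ matched1 M y) :
    f (dist x u) ≤ f (dist x y) := by
  have hf : ({x, u, y} : Set α).Finite := by simp
  have hu : u ∈ R := (h.1.1 _ hmx).2 u (by simp)
  have hxu : x ≠ u := by simpa using (h.1.1 _ hmx).1
  have huy : u ≠ y := by rintro rfl; exact hmy ⟨_, hmx, by simp⟩
  have key : ∀ e ∈ M, (∃ z ∈ e, z ∈ ({x, u, y} : Set α)) → e = s(x, u) := by
    rintro e he ⟨z, hz, rfl | rfl | rfl⟩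
    · exact h.1.2 _ he _ hmx _ hz (by simp)
    · exact h.1.2 _ he _ hmx _ hz (by simp)
    · exact absurd ⟨e, he, hz⟩ hmy
  have H := h.2 {x, u, y} (by grind) hf (by
    intro e he hz
    rw [key e he hz]
    simp)
  have hm : IsMatch1 {x, u, y} {s(x, y)} := by
    refine ⟨?_, ?_⟩
    · rintro e rfl
      simp [hxy]
    · rintro e rfl e' rfl z _ _; rfl
  have h0 : unm1 {x, u, y} {s(x, y)} = 1 := by
    have : {z ∈ ({x, u, y} : Set α) | ¬ matched1 {s(x, y)} z} = {u} := by
      ext z; simp [matched1]; grind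
    rw [unm1, this, Set.ncard_singleton]
  have hp := unm1_lt_absurd (M := restr1 M {x, u, y}) hf (x := y) (by simp)
    (fun ⟨e, he, hz⟩ => hmy ⟨e, he.1, hz⟩)
  have hr : restr1 M {x, u, y} = {s(x, u)} := by
    ext e
    constructor
    · rintro ⟨he, hz⟩
      induction e with | _ p q => exact key _ he ⟨p, by simp, hz p (by simp)⟩
    · rintro rfl
      exact ⟨hmx, by simp⟩
  rcases H.2 _ hm with h1 | h1
  · omega
  · have := h1.2
    rw [hr] at this
    simpa [cost1, finsum_mem_singleton, edgeLen] using this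

lemma one_full {f : ℝ → ℝ} {R : Set α} {M : Set (Sym2 α)} (h : Min1 f R M) {x y u v : α}
    (hx : x ∈ R) (hy : y ∈ R) (hxy : x ≠ y) (hmx : s(x, u) ∈ M) (hmy : s(y, v) ∈ M)
    (huy : u ≠ y) :
    u ≠ v ∧ f (dist x u) + f (dist y v) ≤ f (dist x y) + f (dist u v) := by
  have hf : ({x, u, y, v} : Set α).Finite := by simp
  have hu : u ∈ R := (h.1.1 _ hmx).2 u (by simp)
  have hv : v ∈ R := (h.1.1 _ hmy).2 v (by simp)
  have hxu : x ≠ u := by simpa using (h.1.1 _ hmx).1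
  have hyv : y ≠ v := by simpa using (h.1.1 _ hmy).1
  have hne : s(x, u) ≠ s(y, v) := by
    intro e
    have : y ∈ s(x, u) := by rw [e]; simp
    simp at this
    grind
  have huv : u ≠ v := by
    rintro rfl
    exact hne (h.1.2 _ hmx _ hmy u (by simp) (by simp))
  have hxv : x ≠ v := by
    rintro rfl
    exact hne (h.1.2 _ hmx _ hmy x (by simp) (by simp))
  refine ⟨huv, ?_⟩
  have key : ∀ e ∈ M, (∃ z ∈ e, z ∈ ({x, u, y, v} : Set α)) → e = s(x, u) ∨ e = s(y, v) := by
    rintro e he ⟨z, hz, rfl | rfl | rfl | rfl⟩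
    · exact Or.inl (h.1.2 _ he _ hmx _ hz (by simp))
    · exact Or.inl (h.1.2 _ he _ hmx _ hz (by simp))
    · exact Or.inr (h.1.2 _ he _ hmy _ hz (by simp))
    · exact Or.inr (h.1.2 _ he _ hmy _ hz (by simp))
  have H := h.2 {x, u, y, v} (by grind) hf (by
    intro e he hz
    rcases key e he hz with rfl | rfl <;> simp)
  have hm : IsMatch1 {x, u, y, v} {s(x, y), s(u, v)} := by
    refine ⟨?_, ?_⟩
    · rintro e (rfl | rfl)
      · simp [hxy]
      · simp [huv]
    · rintro e (rfl | rfl) e' (rfl | rfl) z h1 h2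
      · rfl
      · simp at h1 h2; grind
      · simp at h1 h2; grind
      · rfl
  have h0 : unm1 {x, u, y, v} {s(x, y), s(u, v)} = 0 := by
    have : {z ∈ ({x, u, y, v} : Set α) | ¬ matched1 {s(x, y), s(u, v)} z} = ∅ := by
      ext z; simp [matched1]; tauto
    rw [unm1, this, Set.ncard_empty]
  have hr : restr1 M {x, u, y, v} = {s(x, u), s(y, v)} := by
    ext e
    constructor
    · rintro ⟨he, hz⟩
      induction e with | _ p q => exact key _ he ⟨p, by simp, hz p (by simp)⟩
    · rintro (rfl | rfl)
      · exact ⟨hmx, by simp⟩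
      · exact ⟨hmy, by simp⟩
  have hne2 : s(x, y) ≠ s(u, v) := by
    intro e
    have : x ∈ s(u, v) := by rw [← e]; simp
    simp at this
    grind
  rcases H.2 _ hm with h1 | h1
  · omega
  · have := h1.2
    rw [hr] at this
    rw [cost1, cost1, finsum_mem_pair hne, finsum_mem_pair hne2] at this
    exact this

lemma main1 (γ κ : ℝ) (hκ : 1 ≤ κ) (hk : ∀ r a b : ℝ, 0 < r →
    κ * r < a → κ * r < b → fgam γ r + fgam γ (a + b + r) < fgam γ a + fgam γ b)
    (R : Set α) (M : Set (Sym2 α)) (h : Min1 (fgam γ) R M) (x : α) (hx : x ∈ R)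
    (y : α) (hy : y ∈ R) (hxy : x ≠ y) :
    (∃ e ∈ M, x ∈ e ∧ edgeLen e ≤ κ * dist x y) ∨
    (∃ e ∈ M, y ∈ e ∧ edgeLen e ≤ κ * dist x y) := by
  have hr : 0 < dist x y := dist_pos.2 hxy
  have hrk : dist x y ≤ κ * dist x y := le_mul_of_one_le_left hr.le hκ
  have half : ∀ {x y u : α}, x ∈ R → y ∈ R → x ≠ y → s(x, u) ∈ M → ¬ matched1 M y →
      dist x u ≤ dist x y := by
    intro x y u hx hy hxy h1 h2
    by_contra hc
    have h3 := one_half h hx hy hxy h1 h2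
    have h4 := fgam_strictMono γ (dist_pos.2 hxy) (not_le.1 hc)
    linarith
  by_cases hmx : matched1 M x
  · obtain ⟨e, he, u, rfl⟩ := hmx
    by_cases hmy : matched1 M y
    · obtain ⟨e', he', v, rfl⟩ := hmy
      by_contra! hc
      have c1 := hc.1 _ he (by simp)
      have c2 := hc.2 _ he' (by simp)
      change _ < dist x u at c1
      change _ < dist y v at c2
      have huy : u ≠ y := by rintro rfl; linarith
      obtain ⟨huv, hle⟩ := one_full h hx hy hxy he he' huy
      have h1 := hk _ _ _ hr c1 c2
      have tri : dist u v ≤ dist x u + dist y v + dist x y := by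
        have := dist_triangle4 u x y v
        rw [dist_comm u x] at this
        linarith
      have h2 := fgam_mono γ (dist_pos.2 huv) tri
      linarith
    · exact Or.inl ⟨_, he, by simp, (half hx hy hxy he hmy).trans hrk⟩
  · by_cases hmy : matched1 M y
    · obtain ⟨e', he', v, rfl⟩ := hmy
      have := half hy hx hxy.symm he' hmx
      rw [dist_comm y x] at this
      exact Or.inr ⟨_, he', by simp, this.trans hrk⟩
    · exact (one_none h hx hy hxy hmx hmy).elim

lemma unm2_pos_l {R B : Set α} {M : Set (α × α)} (hR : R.Finite) {x : α} (hx : x ∈ R)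
    (hm : ¬ ∃ b, (x, b) ∈ M) : 0 < unm2 R B M :=
  Nat.add_pos_left ((Set.ncard_pos (hR.subset (Set.sep_subset _ _))).2 ⟨x, hx, hm⟩) _

lemma unm2_pos_r {R B : Set α} {M : Set (α × α)} (hB : B.Finite) {y : α} (hy : y ∈ B)
    (hm : ¬ ∃ r, (r, y) ∈ M) : 0 < unm2 R B M :=
  Nat.add_pos_right _ ((Set.ncard_pos (hB.subset (Set.sep_subset _ _))).2 ⟨y, hy, hm⟩)

lemma two_none {f : ℝ → ℝ} {R B : Set α} {M : Set (α × α)} (h : Min2 f R B M) {x y : α}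
    (hx : x ∈ R) (hy : y ∈ B) (hmx : ¬ ∃ b, (x, b) ∈ M) (hmy : ¬ ∃ r, (r, y) ∈ M) :
    False := by
  have H := h.2 {x} {y} (by simpa) (by simpa) (by simp) (by simp) (by
    rintro ⟨p, q⟩ he (h1 | h1)
    · simp at h1; subst h1; exact absurd ⟨_, he⟩ hmx
    · simp at h1; subst h1; exact absurd ⟨_, he⟩ hmy)
  have hm : IsMatch2 {x} {y} {(x, y)} := by
    refine ⟨by simp, ?_, ?_⟩ <;> simp <;> grind
  have h0 : unm2 {x} {y} {(x, y)} = 0 := by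
    have e1 : {z ∈ ({x} : Set α) | ¬ ∃ w, (z, w) ∈ ({(x, y)} : Set (α × α))} = ∅ := by
      ext z; simp
    have e2 : {w ∈ ({y} : Set α) | ¬ ∃ z, (z, w) ∈ ({(x, y)} : Set (α × α))} = ∅ := by
      ext z; simp
    rw [unm2, e1, e2, Set.ncard_empty]
  have hp := unm2_pos_l (R := {x}) (B := {y}) (M := restr2 M {x} {y}) (by simp) (x := x) (by simp)
    (fun ⟨b, he⟩ => hmx ⟨b, he.1⟩)
  rcases H.2 _ hm with h1 | h1 <;> omega

lemma two_halfx {f : ℝ → ℝ} {R B : Set α} {M : Set (α × α)} (h : Min2 f R B M) {x y u : α}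
    (hx : x ∈ R) (hy : y ∈ B) (hmx : (x, u) ∈ M) (hmy : ¬ ∃ r, (r, y) ∈ M) :
    f (dist x u) ≤ f (dist x y) := by
  have hu : u ∈ B := (h.1.1 _ hmx).2
  have huy : u ≠ y := by rintro rfl; exact hmy ⟨_, hmx⟩
  have key : ∀ e ∈ M, (e.1 ∈ ({x} : Set α) ∨ e.2 ∈ ({u, y} : Set α)) → e = (x, u) := by
    rintro ⟨p, q⟩ he (h1 | h1 | h1)
    · simp at h1; subst h1; rw [h.1.2.1 _ _ _ he hmx]
    · simp at h1; subst h1; rw [h.1.2.2 _ _ _ he hmx]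
    · simp at h1; subst h1; exact absurd ⟨_, he⟩ hmy
  have H := h.2 {x} {u, y} (by simpa) (by grind) (by simp) (by simp) (by
    intro e he h1
    rw [key e he h1]; simp)
  have hm : IsMatch2 {x} {u, y} {(x, y)} := by
    refine ⟨by simp, ?_, ?_⟩ <;> simp <;> grind
  have h0 : unm2 {x} {u, y} {(x, y)} = 1 := by
    have e1 : {z ∈ ({x} : Set α) | ¬ ∃ w, (z, w) ∈ ({(x, y)} : Set (α × α))} = ∅ := by
      ext z; simp
    have e2 : {w ∈ ({u, y} : Set α) | ¬ ∃ z, (z, w) ∈ ({(x, y)} : Set (α × α))} = {u} := by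
      ext z; simp; grind
    rw [unm2, e1, e2, Set.ncard_empty, Set.ncard_singleton]
  have hp := unm2_pos_r (R := {x}) (B := {u, y}) (M := restr2 M {x} {u, y}) (by simp)
    (y := y) (by simp) (fun ⟨b, he⟩ => hmy ⟨b, he.1⟩)
  have hr : restr2 M {x} {u, y} = {(x, u)} := by
    ext e
    constructor
    · rintro ⟨he, hz⟩
      exact key e he (Or.inl hz.1)
    · rintro rfl
      exact ⟨hmx, by simp⟩
  rcases H.2 _ hm with h1 | h1
  · omega
  · have := h1.2
    rw [hr] at this
    simpa [cost2, finsum_mem_singleton] using this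

lemma two_halfy {f : ℝ → ℝ} {R B : Set α} {M : Set (α × α)} (h : Min2 f R B M) {x y w : α}
    (hx : x ∈ R) (hy : y ∈ B) (hmx : ¬ ∃ b, (x, b) ∈ M) (hmy : (w, y) ∈ M) :
    f (dist w y) ≤ f (dist x y) := by
  have hu : w ∈ R := (h.1.1 _ hmy).1
  have hwx : w ≠ x := by rintro rfl; exact hmx ⟨_, hmy⟩
  have key : ∀ e ∈ M, (e.1 ∈ ({w, x} : Set α) ∨ e.2 ∈ ({y} : Set α)) → e = (w, y) := by
    rintro ⟨p, q⟩ he ((h1 | h1) | h1)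
    · simp at h1; subst h1; rw [h.1.2.1 _ _ _ he hmy]
    · simp at h1; subst h1; exact absurd ⟨_, he⟩ hmx
    · simp at h1; subst h1; rw [h.1.2.2 _ _ _ he hmy]
  have H := h.2 {w, x} {y} (by grind) (by simpa) (by simp) (by simp) (by
    intro e he h1
    rw [key e he h1]; simp)
  have hm : IsMatch2 {w, x} {y} {(x, y)} := by
    refine ⟨by simp, ?_, ?_⟩ <;> simp <;> grind
  have h0 : unm2 {w, x} {y} {(x, y)} = 1 := by
    have e1 : {z ∈ ({w, x} : Set α) | ¬ ∃ w, (z, w) ∈ ({(x, y)} : Set (α × α))} = {w} := by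
      ext z; simp; grind
    have e2 : {w ∈ ({y} : Set α) | ¬ ∃ z, (z, w) ∈ ({(x, y)} : Set (α × α))} = ∅ := by
      ext z; simp
    rw [unm2, e1, e2, Set.ncard_empty, Set.ncard_singleton]
  have hp := unm2_pos_l (R := {w, x}) (B := {y}) (M := restr2 M {w, x} {y}) (by simp)
    (x := x) (by simp) (fun ⟨b, he⟩ => hmx ⟨b, he.1⟩)
  have hr : restr2 M {w, x} {y} = {(w, y)} := by
    ext e
    constructor
    · rintro ⟨he, hz⟩
      exact key e he (Or.inl hz.1)
    · rintro rfl
      exact ⟨hmy, by simp⟩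
  rcases H.2 _ hm with h1 | h1
  · omega
  · have := h1.2
    rw [hr] at this
    simpa [cost2, finsum_mem_singleton] using this

lemma two_full {f : ℝ → ℝ} {R B : Set α} {M : Set (α × α)} (h : Min2 f R B M) {x y u w : α}
    (hx : x ∈ R) (hy : y ∈ B) (hmx : (x, u) ∈ M) (hmy : (w, y) ∈ M) (huy : u ≠ y) :
    f (dist x u) + f (dist w y) ≤ f (dist x y) + f (dist w u) := by
  have hu : u ∈ B := (h.1.1 _ hmx).2
  have hw : w ∈ R := (h.1.1 _ hmy).1
  have hxw : x ≠ w := by rintro rfl; exact huy (h.1.2.1 _ _ _ hmx hmy)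
  have key : ∀ e ∈ M, (e.1 ∈ ({x, w} : Set α) ∨ e.2 ∈ ({u, y} : Set α)) →
      e = (x, u) ∨ e = (w, y) := by
    rintro ⟨p, q⟩ he ((h1 | h1) | (h1 | h1))
    · simp at h1; subst h1; rw [h.1.2.1 _ _ _ he hmx]; simp
    · simp at h1; subst h1; rw [h.1.2.1 _ _ _ he hmy]; simp
    · simp at h1; subst h1; rw [h.1.2.2 _ _ _ he hmx]; simp
    · simp at h1; subst h1; rw [h.1.2.2 _ _ _ he hmy]; simp
  have H := h.2 {x, w} {u, y} (by grind) (by grind) (by simp) (by simp) (by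
    intro e he h1
    rcases key e he h1 with rfl | rfl <;> simp)
  have hm : IsMatch2 {x, w} {u, y} {(x, y), (w, u)} := by
    refine ⟨?_, ?_, ?_⟩
    · rintro e (rfl | rfl) <;> simp
    · intro p q q' h1 h2; simp at h1 h2; grind
    · intro p q q' h1 h2; simp at h1 h2; grind
  have h0 : unm2 {x, w} {u, y} {(x, y), (w, u)} = 0 := by
    have e1 : {z ∈ ({x, w} : Set α) | ¬ ∃ t, (z, t) ∈ ({(x, y), (w, u)} : Set (α × α))} = ∅ := by
      refine Set.eq_empty_of_forall_notMem ?_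
      rintro z ⟨rfl | rfl, h2⟩
      · exact h2 ⟨y, by simp⟩
      · exact h2 ⟨u, by simp⟩
    have e2 : {t ∈ ({u, y} : Set α) | ¬ ∃ z, (z, t) ∈ ({(x, y), (w, u)} : Set (α × α))} = ∅ := by
      refine Set.eq_empty_of_forall_notMem ?_
      rintro z ⟨rfl | rfl, h2⟩
      · exact h2 ⟨w, by simp⟩
      · exact h2 ⟨x, by simp⟩
    rw [unm2, e1, e2, Set.ncard_empty]
  have hr : restr2 M {x, w} {u, y} = {(x, u), (w, y)} := by
    ext e
    constructor
    · rintro ⟨he, hz⟩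
      exact key e he (Or.inl hz.1)
    · rintro (rfl | rfl)
      · exact ⟨hmx, by simp⟩
      · exact ⟨hmy, by simp⟩
  have hne : (x, u) ≠ (w, y) := by simp [hxw]
  have hne2 : (x, y) ≠ (w, u) := by simp [hxw]
  rcases H.2 _ hm with h1 | h1
  · omega
  · have := h1.2
    rw [hr] at this
    rw [cost2, cost2, finsum_mem_pair hne, finsum_mem_pair hne2] at this
    exact this

lemma main2 (γ κ : ℝ) (hκ : 1 ≤ κ) (hk : ∀ r a b : ℝ, 0 < r →
    κ * r < a → κ * r < b → fgam γ r + fgam γ (a + b + r) < fgam γ a + fgam γ b)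
    (R B : Set α) (M : Set (α × α)) (hd : Disjoint R B) (h : Min2 (fgam γ) R B M) (x : α)
    (hx : x ∈ R) (y : α) (hy : y ∈ B) :
    (∃ b, (x, b) ∈ M ∧ dist x b ≤ κ * dist x y) ∨
    (∃ r, (r, y) ∈ M ∧ dist r y ≤ κ * dist x y) := by
  have hr : 0 < dist x y := dist_pos.2 (Set.disjoint_iff_forall_ne.1 hd hx hy)
  have hrk : dist x y ≤ κ * dist x y := le_mul_of_one_le_left hr.le hκ
  have up : ∀ a : ℝ, fgam γ a ≤ fgam γ (dist x y) → a ≤ κ * dist x y := by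
    intro a ha
    by_contra hc
    have := fgam_strictMono γ hr (hrk.trans_lt (not_le.1 hc))
    linarith
  by_cases hmx : ∃ b, (x, b) ∈ M
  · obtain ⟨u, hu⟩ := hmx
    by_cases hmy : ∃ r, (r, y) ∈ M
    · obtain ⟨w, hw⟩ := hmy
      by_contra! hc
      have c1 := hc.1 _ hu
      have c2 := hc.2 _ hw
      have huy : u ≠ y := by rintro rfl; linarith
      have hle := two_full h hx hy hu hw huy
      have h1 := hk _ _ _ hr c1 c2
      have hwu : w ≠ u := Set.disjoint_iff_forall_ne.1 hd (h.1.1 _ hw).1 (h.1.1 _ hu).2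
      have tri : dist w u ≤ dist x u + dist w y + dist x y := by
        have := dist_triangle4 w y x u
        rw [dist_comm y x] at this
        linarith
      have h2 := fgam_mono γ (dist_pos.2 hwu) tri
      linarith
    · exact Or.inl ⟨u, hu, up _ (two_halfx h hx hy hu hmy)⟩
  · by_cases hmy : ∃ r, (r, y) ∈ M
    · obtain ⟨w, hw⟩ := hmy
      exact Or.inr ⟨w, hw, up _ (two_halfy h hx hy hmx hw)⟩
    · exact (two_none h hx hy hmx hmy).elim

end

/-- Quasistability: for every `γ < 1` there is `κ ∈ [1,∞)` such that in any
`γ`-minimal matching (1-colour, or 2-colour with `x`, `y` of opposite colours) of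
subsets of `ℝ^d`, `min(|x - M(x)|, |y - M(y)|) ≤ κ |x - y|`, where an unmatched
point is regarded as being at infinite distance from its partner. -/
theorem stmt_12 (γ : ℝ) (hγ : γ < 1) :
    ∃ κ : ℝ, 1 ≤ κ ∧ ∀ d : ℕ, 1 ≤ d →
      (∀ (R : Set (EuclideanSpace ℝ (Fin d))) (M : Set (Sym2 (EuclideanSpace ℝ (Fin d)))),
        Min1 (fgam γ) R M → ∀ x ∈ R, ∀ y ∈ R, x ≠ y →
          (∃ e ∈ M, x ∈ e ∧ edgeLen e ≤ κ * dist x y) ∨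
          (∃ e ∈ M, y ∈ e ∧ edgeLen e ≤ κ * dist x y)) ∧
      (∀ (R B : Set (EuclideanSpace ℝ (Fin d)))
          (M : Set (EuclideanSpace ℝ (Fin d) × EuclideanSpace ℝ (Fin d))),
        Disjoint R B → Min2 (fgam γ) R B M → ∀ x ∈ R, ∀ y ∈ B,
          (∃ b, (x, b) ∈ M ∧ dist x b ≤ κ * dist x y) ∨
          (∃ r, (r, y) ∈ M ∧ dist r y ≤ κ * dist x y)) := by
  obtain ⟨κ, hκ, hk⟩ := key γ hγ
  refine ⟨κ, hκ, fun d _ => ⟨?_, ?_⟩⟩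
  · intro R M h x hx y hy hxy
    exact main1 γ κ hκ hk R M h x hx y hy hxy
  · intro R B M hd h x hx y hy
    exact main2 γ κ hκ hk R B M hd h x hx y hy
end

section
/- For every γ ∈ ℝ with γ < 1 there exists κ ∈ [1, ∞) such that for every d ≥ 1 and all points x, y, x', y' ∈ ℝ^d with x ≠ y and x' ≠ y': if |x − x'| > κ|x − y| and |y − y'| > κ|x − y|, then f_γ(|x − x'|) + f_γ(|y − y'|) > f_γ(|x − y|) + f_γ(|x' − y'|). -/
lemma pos_aux (γ : ℝ) (h0 : 0 < γ) (h1 : γ < 1) (a b c e t : ℝ) (ha : 0 < a) (hab : a ≤ b)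
    (hc : 0 < c) (he : 0 < e) (hle : e ≤ a + b + c) (ht : 0 < t) (ht1 : t ≤ 1)
    (htg : t ^ γ = (1 - γ) / 2) (hca : c < t * a) :
    c ^ γ + e ^ γ < a ^ γ + b ^ γ := by
  have hb : 0 < b := ha.trans_le hab
  have htt : t ≤ (1 - γ) / 2 := by
    rw [← htg]
    calc t = t ^ (1:ℝ) := (Real.rpow_one t).symm
      _ ≤ t ^ γ := Real.rpow_le_rpow_of_exponent_ge ht ht1 h1.le
  have hcg : c ^ γ < (1 - γ) / 2 * a ^ γ := by
    rw [← htg, ← Real.mul_rpow ht.le ha.le]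
    exact Real.rpow_lt_rpow hc.le hca h0
  have hs : 0 ≤ (a + c) / b := by positivity
  have hber : (1 + (a + c) / b) ^ γ ≤ 1 + γ * ((a + c) / b) :=
    rpow_one_add_le_one_add_mul_self (by linarith) h0.le h1.le
  have hbg : 0 < b ^ γ := Real.rpow_pos_of_pos hb γ
  have hag : 0 < a ^ γ := Real.rpow_pos_of_pos ha γ
  have heg : e ^ γ ≤ b ^ γ + γ * (a + c) * b ^ (γ - 1) := by
    calc e ^ γ ≤ (b * (1 + (a + c) / b)) ^ γ := by
          apply Real.rpow_le_rpow he.le _ h0.le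
          have : b * (1 + (a + c) / b) = a + b + c := by field_simp; ring
          rw [this]; exact hle
      _ = b ^ γ * (1 + (a + c) / b) ^ γ := Real.mul_rpow hb.le (by linarith)
      _ ≤ b ^ γ * (1 + γ * ((a + c) / b)) := by gcongr
      _ = b ^ γ + γ * (a + c) * b ^ (γ - 1) := by
          rw [Real.rpow_sub_one hb.ne']; field_simp
  have hanti : b ^ (γ - 1) ≤ a ^ (γ - 1) :=
    Real.rpow_le_rpow_of_nonpos ha hab (by linarith)
  have h2 : γ * (a + c) * b ^ (γ - 1) ≤ γ * (a + c) * a ^ (γ - 1) := by gcongr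
  have h3 : γ * (a + c) * a ^ (γ - 1) ≤ γ * (1 + (1 - γ) / 2) * a ^ γ := by
    have h4 : a + c ≤ (1 + (1 - γ) / 2) * a := by nlinarith
    calc γ * (a + c) * a ^ (γ - 1) ≤ γ * ((1 + (1 - γ) / 2) * a) * a ^ (γ - 1) := by gcongr
      _ = _ := by rw [Real.rpow_sub_one ha.ne']; field_simp
  have h5 : γ * (1 + (1 - γ) / 2) + (1 - γ) / 2 < 1 := by nlinarith
  nlinarith

lemma real_aux (γ : ℝ) (hγ : γ < 1) :
    ∃ κ : ℝ, 1 ≤ κ ∧ ∀ a b c e : ℝ, a ≤ b → 0 < c → 0 < e → e ≤ a + b + c →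
      κ * c < a → fgam γ c + fgam γ e < fgam γ a + fgam γ b := by
  rcases lt_trichotomy γ 0 with h | h | h
  · have hk : ((1/2 : ℝ) ^ (1/γ)) ^ γ = 1/2 := by
      rw [← Real.rpow_mul (by norm_num)]
      rw [one_div_mul_cancel h.ne, Real.rpow_one]
    refine ⟨(1/2 : ℝ) ^ (1/γ), ?_, ?_⟩
    · exact Real.one_le_rpow_of_pos_of_le_one_of_nonpos (by norm_num) (by norm_num)
        (one_div_nonpos.mpr h.le)
    · intro a b c e hab hc he hle hca
      have hkp : (0:ℝ) < (1/2 : ℝ) ^ (1/γ) := by positivity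
      have key : ∀ z, (1/2 : ℝ) ^ (1/γ) * c < z → z ^ γ < 1/2 * c ^ γ := by
        intro z hz
        have := Real.rpow_lt_rpow_of_neg (by positivity) hz h
        rwa [Real.mul_rpow hkp.le hc.le, hk] at this
      have h1 := key a hca
      have h2 := key b (hca.trans_le hab)
      have h3 : 0 < e ^ γ := Real.rpow_pos_of_pos he γ
      simp only [fgam, if_neg h.not_gt, if_neg h.ne]
      linarith
  · refine ⟨3, by norm_num, ?_⟩
    intro a b c e hab hc he hle hca
    have ha : 0 < a := by linarith
    have hb : 0 < b := by linarith
    simp only [fgam, h, lt_irrefl, if_false, if_true]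
    rw [← Real.log_mul hc.ne' he.ne', ← Real.log_mul ha.ne' hb.ne']
    apply Real.log_lt_log (by positivity)
    have h1 : c * e ≤ c * (3 * b) := by gcongr; linarith
    nlinarith
  · have ht : 0 < ((1 - γ) / 2) ^ (1/γ) := Real.rpow_pos_of_pos (by linarith) _
    have ht1 : ((1 - γ) / 2) ^ (1/γ) ≤ 1 :=
      Real.rpow_le_one (by linarith) (by linarith) (by positivity)
    have htg : (((1 - γ) / 2) ^ (1/γ)) ^ γ = (1 - γ) / 2 := by
      rw [← Real.rpow_mul (by linarith), one_div_mul_cancel h.ne', Real.rpow_one]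
    refine ⟨(((1 - γ) / 2) ^ (1/γ))⁻¹, (one_le_inv₀ ht).mpr ht1, ?_⟩
    intro a b c e hab hc he hle hca
    have ha : 0 < a := lt_trans (by positivity) hca
    simp only [fgam, if_pos h]
    exact pos_aux γ h hγ a b c e _ ha hab hc he hle ht ht1 htg ((inv_mul_lt_iff₀ ht).mp hca)

theorem stmt_13 (γ : ℝ) (hγ : γ < 1) :
    ∃ κ : ℝ, 1 ≤ κ ∧ ∀ d : ℕ, 1 ≤ d →
      ∀ x y x' y' : EuclideanSpace ℝ (Fin d), x ≠ y → x' ≠ y' →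
        κ * dist x y < dist x x' → κ * dist x y < dist y y' →
        fgam γ (dist x y) + fgam γ (dist x' y') < fgam γ (dist x x') + fgam γ (dist y y') := by
  obtain ⟨κ, hκ, H⟩ := real_aux γ hγ
  refine ⟨κ, hκ, ?_⟩
  intro d _ x y x' y' hxy hxy' h1 h2
  have ht : dist x' y' ≤ dist x x' + dist y y' + dist x y := by
    have := dist_triangle4 x' x y y'
    rw [dist_comm x' x] at this
    linarith
  rcases le_total (dist x x') (dist y y') with h | h
  · exact H _ _ _ _ h (dist_pos.mpr hxy) (dist_pos.mpr hxy') ht h1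
  · have := H _ _ _ _ h (dist_pos.mpr hxy) (dist_pos.mpr hxy') (by linarith) h2
    linarith
end

section
/- Let γ > 1 be a real number, let n ≥ 1, and let r_1 < r_2 < ⋯ < r_n and b_1 < b_2 < ⋯ < b_n be real numbers. Then for every permutation σ of {1,…,n} with σ ≠ id, Σ_{i=1}^{n} |r_i − b_{σ(i)}|^γ > Σ_{i=1}^{n} |r_i − b_i|^γ; that is, the order-preserving assignment is the unique minimizer of the cost Σ_i |r_i − b_{σ(i)}|^γ over permutations σ. -/
theorem aux_convex (γ : ℝ) (hγ : 1 < γ) : StrictConvexOn ℝ Set.univ (fun x : ℝ => |x| ^ γ) := by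
  refine ⟨convex_univ, ?_⟩
  intro x _ y _ hxy a b ha hb hab
  simp only [smul_eq_mul]
  have h1 : |a * x + b * y| ≤ a * |x| + b * |y| := by
    calc |a * x + b * y| ≤ |a * x| + |b * y| := abs_add_le _ _
      _ = _ := by rw [abs_mul, abs_mul, abs_of_pos ha, abs_of_pos hb]
  by_cases h : |x| = |y|
  · have hx : x = -y := by
      rcases abs_eq_abs.1 h with h | h
      · exact absurd h hxy
      · exact h
    have hy : y ≠ 0 := by
      rintro rfl
      simp at hx
      exact hxy hx
    have e : |a * x + b * y| < |y| := by
      have : a * x + b * y = (b - a) * y := by rw [hx]; ring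
      rw [this, abs_mul]
      have h2 : |b - a| < 1 := by rw [abs_lt]; constructor <;> linarith
      have := abs_pos.2 hy
      nlinarith
    have := Real.rpow_lt_rpow (abs_nonneg _) e (by linarith : 0 < γ)
    rw [h, ← add_mul, hab, one_mul]
    exact this
  · have := (strictConvexOn_rpow hγ).2 (abs_nonneg x) (abs_nonneg y) h ha hb hab
    simp only [smul_eq_mul] at this
    exact lt_of_le_of_lt (Real.rpow_le_rpow (abs_nonneg _) h1 (by linarith)) this

theorem aux_exch (f : ℝ → ℝ) (hf : StrictConvexOn ℝ Set.univ f) (r s b c : ℝ) (h1 : r < s)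
    (h2 : b < c) : f (r - b) + f (s - c) < f (r - c) + f (s - b) := by
  have hd : 0 < (s - r) + (c - b) := by linarith
  set d := (s - r) + (c - b) with hdd
  have hu : 0 < (s - r) / d := div_pos (by linarith) hd
  have hv : 0 < (c - b) / d := div_pos (by linarith) hd
  have huv : (s - r) / d + (c - b) / d = 1 := by rw [← add_div]; exact div_self hd.ne'
  have hne : r - c ≠ s - b := by intro h; linarith
  have A := hf.2 (Set.mem_univ (r - c)) (Set.mem_univ (s - b)) hne hu hv huv
  have B := hf.2 (Set.mem_univ (r - c)) (Set.mem_univ (s - b)) hne hv hu (by linarith)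
  simp only [smul_eq_mul] at A B
  have eA : (s - r) / d * (r - c) + (c - b) / d * (s - b) = r - b := by
    field_simp; rw [hdd]; ring
  have eB : (c - b) / d * (r - c) + (s - r) / d * (s - b) = s - c := by
    field_simp; rw [hdd]; ring
  rw [eA] at A
  rw [eB] at B
  have : (s - r) / d = 1 - (c - b) / d := by linarith
  rw [this] at A B
  linarith

/-- For `γ > 1` and increasing reals `r₁ < ⋯ < r_n`, `b₁ < ⋯ < b_n`, the
order-preserving assignment is the unique minimizer of `Σᵢ |rᵢ - b_{σ(i)}|^γ`
over permutations `σ`. -/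
theorem stmt_18 (γ : ℝ) (hγ : 1 < γ) (n : ℕ) (hn : 1 ≤ n)
    (r b : Fin n → ℝ) (hr : StrictMono r) (hb : StrictMono b) :
    ∀ σ : Equiv.Perm (Fin n), σ ≠ 1 →
      ∑ i, |r i - b i| ^ γ < ∑ i, |r i - b (σ i)| ^ γ := by
  have key : ∀ σ : Equiv.Perm (Fin n), σ ≠ 1 → ∃ τ : Equiv.Perm (Fin n),
      ∑ i, |r i - b (τ i)| ^ γ < ∑ i, |r i - b (σ i)| ^ γ := by
    intro σ hσ
    have hm : ¬ StrictMono σ := by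
      intro h
      apply hσ
      have := (StrictMono.range_inj h strictMono_id).1 (by simp)
      ext i
      simp [this]
    simp only [StrictMono, not_forall, not_lt] at hm
    obtain ⟨i, j, hij, hle⟩ := hm
    have hlt : σ j < σ i := lt_of_le_of_ne hle (fun h => hij.ne' (σ.injective h))
    refine ⟨σ * Equiv.swap i j, ?_⟩
    rw [← sub_neg, ← Finset.sum_sub_distrib, Fintype.sum_eq_add i j hij.ne]
    · have := aux_exch _ (aux_convex γ hγ) _ _ _ _ (hr hij) (hb hlt)
      simp only [Equiv.Perm.mul_apply, Equiv.swap_apply_left, Equiv.swap_apply_right]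
      linarith
    · rintro k ⟨h1, h2⟩
      simp [Equiv.swap_apply_of_ne_of_ne h1 h2]
  obtain ⟨τ, hτ⟩ := Finite.exists_min
    (fun σ : Equiv.Perm (Fin n) => ∑ i, |r i - b (σ i)| ^ γ)
  have h1 : τ = 1 := by
    by_contra h
    obtain ⟨ρ, hρ⟩ := key τ h
    exact absurd (hτ ρ) (not_le.2 hρ)
  subst h1
  intro σ hσ
  obtain ⟨ρ, hρ⟩ := key σ hσ
  exact lt_of_le_of_lt (hτ ρ) hρ
end
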